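/- There exists an absolute constant C > 0 with the following property: for every σ > 0, every bounded continuous function f : ℝ² → ℂ whose Fourier transform (in the distributional sense) is supported in the closed disc {ξ ∈ ℝ² : |ξ| ≤ σ}, and all bounded normal operators N₁, N₂ on a complex Hilbert space H, one has ‖f(N₁) − f(N₂)‖ ≤ C · σ · ‖f‖_{L∞} · ‖N₁ − N₂‖. -/

import Mathlib

open MeasureTheory Filter
open scoped FourierTransform

/-- A bounded continuous function `f : ℂ → ℂ` (identifying `ℝ²` with `ℂ`) has its
Fourier transform, in the sense of tempered distributions, supported in the closed
disc of radius `σ` centered at the origin: the pairing of `f` with `𝓕 φ` vanishes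
for every Schwartz function `φ` whose support is disjoint from that disc. -/
def FourierSupportedIn (f : ℂ → ℂ) (σ : ℝ) : Prop :=
  ∀ φ : SchwartzMap ℂ ℂ, Disjoint (tsupport ⇑φ) (Metric.closedBall (0 : ℂ) σ) →
    ∫ x : ℂ, f x * 𝓕 (⇑φ) x = 0

/-- A smooth frequency cutoff, equal to `1` on the disc of radius `2`. -/
noncomputable def freqBump : ContDiffBump (0 : ℂ) := ⟨2, 3, by norm_num, by norm_num⟩

/-- The frequency cutoff at scale `r⁻¹`, modulated by the character of `x`. -/
noncomputable def modulatedBump (x : ℂ) (r : ℝ) (ξ : ℂ) : ℂ :=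
  (Real.fourierChar (inner ℝ ξ x) : ℂ) * (freqBump (r • ξ) : ℂ)

lemma contDiff_modulatedBump (x : ℂ) (r : ℝ) :
    ContDiff ℝ (⊤ : ℕ∞) (modulatedBump x r) := by
  unfold modulatedBump
  simp_rw [Real.fourierChar_apply]
  refine ContDiff.mul ?_ ?_
  · refine ContDiff.cexp ?_
    refine ContDiff.mul ?_ contDiff_const
    exact Complex.ofRealCLM.contDiff.comp
      (contDiff_const.mul (contDiff_id.inner ℝ contDiff_const))
  · exact Complex.ofRealCLM.contDiff.comp
      (freqBump.contDiff.comp (contDiff_const_smul r))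

lemma hasCompactSupport_modulatedBump (x : ℂ) {r : ℝ} (hr : r ≠ 0) :
    HasCompactSupport (modulatedBump x r) := by
  have h : HasCompactSupport (fun ξ : ℂ => (freqBump (r • ξ) : ℂ)) :=
    (freqBump.hasCompactSupport.comp_smul hr).comp_left (g := fun s : ℝ => (s : ℂ)) rfl
  exact h.mul_left

/-- `modulatedBump` as a Schwartz function. -/
noncomputable def modulatedBumpSchwartz (x : ℂ) (r : ℝ) (hr : r ≠ 0) : SchwartzMap ℂ ℂ :=
  (hasCompactSupport_modulatedBump x hr).toSchwartzMap (contDiff_modulatedBump x r)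

/-- The reproducing kernel: the Fourier transform of the frequency cutoff. -/
noncomputable def reproKernel : SchwartzMap ℂ ℂ :=
  𝓕 (modulatedBumpSchwartz 0 1 one_ne_zero)

lemma fourier_modulatedBump (x : ℂ) {r : ℝ} (hr : r ≠ 0) (t : ℂ) :
    𝓕 (modulatedBump x r) t = |(r ^ 2)⁻¹| • reproKernel (r⁻¹ • (t - x)) := by
  have h0 : (reproKernel : ℂ → ℂ) = 𝓕 (modulatedBump 0 1) := rfl
  rw [h0, Real.fourier_eq, Real.fourier_eq, ← Complex.finrank_real_complex,
    ← Measure.integral_comp_smul]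
  refine integral_congr_ae (Eventually.of_forall fun ξ => ?_)
  change (Real.fourierChar (-inner ℝ ξ t) : ℂ) * modulatedBump x r ξ
    = (Real.fourierChar (-inner ℝ (r • ξ) (r⁻¹ • (t - x))) : ℂ) * modulatedBump 0 1 (r • ξ)
  have h1 : -inner ℝ (r • ξ) (r⁻¹ • (t - x)) = -inner ℝ ξ t + inner ℝ ξ x := by
    rw [inner_smul_left, inner_smul_right, inner_sub_right, conj_trivial]
    field_simp
    ring
  rw [h1, AddChar.map_add_eq_mul, Circle.coe_mul]
  simp only [modulatedBump, inner_zero_right, one_smul, AddChar.map_zero_eq_one, Circle.coe_one]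
  ring

lemma integral_reproKernel : ∫ s : ℂ, reproKernel s = 1 := by
  have h : 𝓕⁻ (reproKernel) = modulatedBumpSchwartz 0 1 one_ne_zero :=
    FourierTransform.fourierInv_fourier_eq _
  have h2 := congrArg (fun φ : SchwartzMap ℂ ℂ => φ 0) h
  simp only [SchwartzMap.fourierInv_coe, Real.fourierInv_eq] at h2
  have h3 : (modulatedBumpSchwartz 0 1 one_ne_zero : SchwartzMap ℂ ℂ) 0 = 1 := by
    change modulatedBump 0 1 0 = 1
    have : freqBump 0 = 1 := freqBump.one_of_mem_closedBall (by simp [freqBump])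
    simp [modulatedBump, this]
  rw [h3] at h2
  simpa using h2

lemma integrable_bcf_mul_schwartz (f : BoundedContinuousFunction ℂ ℂ) (K : SchwartzMap ℂ ℂ)
    {g : ℂ → ℂ} (hg : Continuous g) : Integrable (fun w => f (g w) * K w) :=
  K.integrable.bdd_mul (c := ‖f‖) (f.continuous.comp hg).aestronglyMeasurable
    (Eventually.of_forall fun _ => f.norm_coe_le_norm _)

lemma integral_mul_fourier_modulatedBump (f : BoundedContinuousFunction ℂ ℂ) (x : ℂ) {r : ℝ}
    (hr : r ≠ 0) : ∫ t, f t * 𝓕 (modulatedBump x r) t = ∫ s, f (x + r • s) * reproKernel s := by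
  have h1 : ∫ t, f t * 𝓕 (modulatedBump x r) t
      = ∫ t, f (x + t) * 𝓕 (modulatedBump x r) (x + t) :=
    (integral_add_left_eq_self (μ := volume) (fun t => f t * 𝓕 (modulatedBump x r) t) x).symm
  have h2 := Measure.integral_comp_smul (volume : Measure ℂ)
    (fun s => f (x + s) * reproKernel (r⁻¹ • s)) r
  rw [Complex.finrank_real_complex] at h2
  simp only [inv_smul_smul₀ hr] at h2
  rw [h1, h2, ← integral_smul]
  refine integral_congr_ae (Eventually.of_forall fun s => ?_)
  simp only [fourier_modulatedBump x hr, add_sub_cancel_left, mul_smul_comm]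

lemma integral_dilate_eq {f : BoundedContinuousFunction ℂ ℂ} {σ : ℝ} (hσ : 0 < σ)
    (hf : FourierSupportedIn f σ) (x : ℂ) {r r' : ℝ} (hr : 0 < r) (hr' : 0 < r')
    (h : r ≤ σ⁻¹) (h' : r' ≤ σ⁻¹) :
    ∫ s, f (x + r • s) * reproKernel s = ∫ s, f (x + r' • s) * reproKernel s := by
  have hz : ∀ {ρ : ℝ}, 0 < ρ → ρ ≤ σ⁻¹ → ∀ ξ ∈ Metric.ball (0 : ℂ) (2 * σ),
      freqBump (ρ • ξ) = 1 := by
    intro ρ hρ hρσ ξ hξ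
    refine freqBump.one_of_mem_closedBall ?_
    rw [mem_ball_zero_iff] at hξ
    rw [mem_closedBall_zero_iff, norm_smul, Real.norm_of_nonneg hρ.le]
    change ρ * ‖ξ‖ ≤ 2
    calc ρ * ‖ξ‖ ≤ σ⁻¹ * (2 * σ) := by gcongr
      _ = 2 := by field_simp
  have key := hf (modulatedBumpSchwartz x r hr.ne' - modulatedBumpSchwartz x r' hr'.ne') ?_
  · rw [← SchwartzMap.fourier_coe, sub_eq_add_neg, FourierTransform.fourier_add,
      FourierTransform.fourier_neg, ← sub_eq_add_neg] at key
    have hi := integrable_bcf_mul_schwartz f (𝓕 (modulatedBumpSchwartz x r hr.ne')) continuous_id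
    have hi' := integrable_bcf_mul_schwartz f (𝓕 (modulatedBumpSchwartz x r' hr'.ne'))
      continuous_id
    simp only [sub_apply, mul_sub] at key
    simp only [id] at hi hi'
    rw [integral_sub hi hi', sub_eq_zero] at key
    rw [← integral_mul_fourier_modulatedBump f x hr.ne',
      ← integral_mul_fourier_modulatedBump f x hr'.ne']
    exact key
  · have hsub : tsupport (modulatedBumpSchwartz x r hr.ne' - modulatedBumpSchwartz x r' hr'.ne')
        ⊆ (Metric.ball (0 : ℂ) (2 * σ))ᶜ := by
      refine closure_minimal ?_ Metric.isOpen_ball.isClosed_compl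
      intro ξ hξ hmem
      apply hξ
      change modulatedBump x r ξ - modulatedBump x r' ξ = 0
      rw [modulatedBump, modulatedBump, hz hr h ξ hmem, hz hr' h' ξ hmem, sub_self]
    refine (Set.disjoint_compl_left_iff_subset.2 ?_).mono_left hsub
    exact Metric.closedBall_subset_ball (by linarith)

lemma eq_integral_reproKernel {f : BoundedContinuousFunction ℂ ℂ} {σ : ℝ} (hσ : 0 < σ)
    (hf : FourierSupportedIn f σ) (x : ℂ) {r : ℝ} (hr : 0 < r) (h : r ≤ σ⁻¹) :
    ∫ s, f (x + r • s) * reproKernel s = f x := by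
  have hlim : Tendsto (fun ρ : ℝ => ∫ s, f (x + ρ • s) * reproKernel s) (nhdsWithin 0 (Set.Ioi 0))
      (nhds (∫ s, f x * reproKernel s)) := by
    refine tendsto_integral_filter_of_dominated_convergence (fun s => ‖f‖ * ‖reproKernel s‖)
      (Eventually.of_forall fun ρ => ?_) (Eventually.of_forall fun ρ =>
        Eventually.of_forall fun s => ?_) (reproKernel.integrable.norm.const_mul _)
      (Eventually.of_forall fun s => ?_)
    · exact (integrable_bcf_mul_schwartz f reproKernel (by fun_prop)).aestronglyMeasurable
    · rw [norm_mul]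
      gcongr
      exact f.norm_coe_le_norm _
    · refine Tendsto.mul_const _ ?_
      have hc : Continuous fun ρ : ℝ => f (x + ρ • s) := f.continuous.comp (by fun_prop)
      simpa using (hc.tendsto 0).mono_left nhdsWithin_le_nhds
  rw [integral_const_mul, integral_reproKernel, mul_one] at hlim
  refine tendsto_nhds_unique (tendsto_const_nhds.congr' ?_) hlim
  filter_upwards [Ioc_mem_nhdsGT hr] with ρ hρ
  exact integral_dilate_eq hσ hf x hr hρ.1 h (hρ.2.trans h)

/-- A bounded continuous function reproduced by averaging its translates against `K`. -/
def ReproducedBy (K : SchwartzMap ℂ ℂ) (h : BoundedContinuousFunction ℂ ℂ) : Prop :=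
  ∀ z, ∫ w, h (z + w) * K w = h z

lemma exists_translate_bound (K : SchwartzMap ℂ ℂ) (e : ℂ) :
    ∃ c : ℝ, ∀ w : ℂ, ∀ s ∈ Metric.ball (0 : ℝ) 1,
      ‖K (w - s • e)‖ ≤ c * (1 + ‖w‖) ^ (-3 : ℝ) := by
  have h1 := fun x => SchwartzMap.one_add_le_sup_seminorm_apply (𝕜 := ℝ) (m := (3, 0))
    (k := 3) (n := 0) le_rfl le_rfl K x
  set c₀ : ℝ := 2 ^ 3 * (Finset.Iic (3, 0)).sup
    (fun m : ℕ × ℕ => SchwartzMap.seminorm ℝ m.1 m.2) K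
  refine ⟨c₀ * (1 + ‖e‖) ^ 3, fun w s hs => ?_⟩
  have h2 := h1 (w - s • e)
  rw [norm_iteratedFDeriv_zero] at h2
  have hs' : ‖s • e‖ ≤ ‖e‖ := by
    rw [norm_smul]
    have : ‖s‖ ≤ 1 := by simpa using (mem_ball_zero_iff.1 hs).le
    nlinarith [norm_nonneg e]
  have h3 : 1 + ‖w‖ ≤ (1 + ‖w - s • e‖) * (1 + ‖e‖) := by
    have : ‖w‖ ≤ ‖w - s • e‖ + ‖s • e‖ := by
      simpa using norm_add_le (w - s • e) (s • e)
    nlinarith [norm_nonneg e, norm_nonneg (w - s • e)]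
  have hw : 0 < 1 + ‖w‖ := by positivity
  rw [Real.rpow_neg hw.le, ← div_eq_mul_inv, le_div_iff₀ (by positivity)]
  have h4 : (1 + ‖w‖) ^ (3 : ℝ) = (1 + ‖w‖) ^ 3 := by norm_cast
  rw [h4]
  calc ‖K (w - s • e)‖ * (1 + ‖w‖) ^ 3
      ≤ ‖K (w - s • e)‖ * ((1 + ‖w - s • e‖) * (1 + ‖e‖)) ^ 3 := by gcongr
    _ = ((1 + ‖w - s • e‖) ^ 3 * ‖K (w - s • e)‖) * (1 + ‖e‖) ^ 3 := by ring
    _ ≤ c₀ * (1 + ‖e‖) ^ 3 := by gcongr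

lemma integrable_rpow_neg_three : Integrable fun w : ℂ => (1 + ‖w‖) ^ (-3 : ℝ) :=
  integrable_one_add_norm (by rw [Complex.finrank_real_complex]; norm_num)

open LineDeriv in
/-- Bernstein's inequality for functions reproduced by a Schwartz kernel: the directional
derivative is again reproduced by the kernel. -/
lemma ReproducedBy.exists_lineDeriv {K : SchwartzMap ℂ ℂ} (e : ℂ)
    {h : BoundedContinuousFunction ℂ ℂ} (hh : ReproducedBy K h) :
    ∃ h' : BoundedContinuousFunction ℂ ℂ, ReproducedBy K h' ∧
      ‖h'‖ ≤ (∫ w, ‖(∂_{e} K : SchwartzMap ℂ ℂ) w‖) * ‖h‖ ∧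
      ∀ (z : ℂ) (s : ℝ), HasDerivAt (fun s : ℝ => h (z + s • e)) (h' (z + s • e)) s := by
  set L : SchwartzMap ℂ ℂ := ∂_{e} K
  have hbound : ∀ z w, ‖h (z + w) * -L w‖ ≤ ‖h‖ * ‖L w‖ := fun z w => by
    rw [norm_mul, norm_neg]
    gcongr
    exact h.norm_coe_le_norm _
  have hcont : Continuous fun z => ∫ w, h (z + w) * -L w := by
    refine continuous_of_dominated (bound := fun w => ‖h‖ * ‖L w‖) (fun z => ?_)
      (fun z => Eventually.of_forall fun w => hbound z w) (L.integrable.norm.const_mul _)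
      (Eventually.of_forall fun w => ?_)
    · have := (integrable_bcf_mul_schwartz h (-L) (g := fun w => z + w) (by fun_prop))
      exact this.aestronglyMeasurable
    · exact (h.continuous.comp (by fun_prop)).mul continuous_const
  have hnorm : ∀ z, ‖∫ w, h (z + w) * -L w‖ ≤ (∫ w, ‖L w‖) * ‖h‖ := fun z => by
    rw [mul_comm, ← integral_const_mul]
    exact norm_integral_le_of_norm_le (L.integrable.norm.const_mul _)
      (Eventually.of_forall fun w => hbound z w)
  set h' : BoundedContinuousFunction ℂ ℂ :=
    BoundedContinuousFunction.ofNormedAddCommGroup _ hcont _ hnorm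
  have hderiv₀ : ∀ z, HasDerivAt (fun s : ℝ => h (z + s • e)) (h' z) 0 := by
    intro z
    obtain ⟨c, hc⟩ := exists_translate_bound L e
    have heq : (fun s : ℝ => h (z + s • e)) = fun s : ℝ => ∫ w, h (z + w) * K (w - s • e) := by
      funext s
      rw [← hh (z + s • e), ← integral_sub_right_eq_self _ (s • e)]
      refine integral_congr_ae (Eventually.of_forall fun w => ?_)
      simp only [add_assoc, add_sub_cancel]
    have hm : ∀ (M : SchwartzMap ℂ ℂ) (s : ℝ),
        AEStronglyMeasurable (fun w => h (z + w) * M (w - s • e)) volume := fun M s =>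
      Continuous.aestronglyMeasurable ((h.continuous.comp (by fun_prop)).mul
        (M.continuous.comp (by fun_prop)))
    have key := hasDerivAt_integral_of_dominated_loc_of_deriv_le (μ := (volume : Measure ℂ))
      (F := fun (s : ℝ) w => h (z + w) * K (w - s • e))
      (F' := fun (s : ℝ) w => h (z + w) * -L (w - s • e)) (x₀ := 0)
      (bound := fun w => ‖h‖ * (c * (1 + ‖w‖) ^ (-3 : ℝ)))
      (Metric.ball_mem_nhds (0 : ℝ) one_pos) (Eventually.of_forall fun s => hm K s)
      (by simpa using integrable_bcf_mul_schwartz h K (g := fun w => z + w) (by fun_prop))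
      (hm (-L) 0)
      (Eventually.of_forall fun w s hs => ?_)
      ((integrable_rpow_neg_three.const_mul c).const_mul _)
      (Eventually.of_forall fun w s _ => ?_)
    · have h0 : h' z = ∫ w, h (z + w) * -L (w - (0 : ℝ) • e) := by
        simp only [zero_smul, sub_zero]
        rfl
      rw [heq, h0]
      exact key.2
    · rw [norm_mul, norm_neg]
      gcongr
      · exact h.norm_coe_le_norm _
      · exact hc w s hs
    · refine HasDerivAt.const_mul _ ?_
      have hK : HasFDerivAt K (fderiv ℝ K (w - s • e)) (w - s • e) :=
        K.differentiableAt.hasFDerivAt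
      have hlin : HasDerivAt (fun s : ℝ => w - s • e) (-e) s := by
        simpa using ((hasDerivAt_id s).smul_const e).const_sub w
      have := hK.comp_hasDerivAt s hlin
      rw [map_neg] at this
      rwa [SchwartzMap.lineDerivOp_apply_eq_fderiv]
  have hderiv : ∀ (z : ℂ) (s : ℝ),
      HasDerivAt (fun s : ℝ => h (z + s • e)) (h' (z + s • e)) s := by
    intro z s
    have h1 := hderiv₀ (z + s • e)
    rw [← sub_self s] at h1
    refine (h1.comp_sub_const s s).congr_of_eventuallyEq (Eventually.of_forall fun t => ?_)
    simp only [add_assoc, ← add_smul, add_sub_cancel]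
  refine ⟨h', fun z => ?_, ?_, hderiv⟩
  · have key := hasDerivAt_integral_of_dominated_loc_of_deriv_le (μ := (volume : Measure ℂ))
      (F := fun (s : ℝ) w => h (z + w + s • e) * K w)
      (F' := fun (s : ℝ) w => h' (z + w + s • e) * K w) (x₀ := 0)
      (bound := fun w => ‖h'‖ * ‖K w‖)
      (Metric.ball_mem_nhds (0 : ℝ) one_pos)
      (Eventually.of_forall fun s =>
        (integrable_bcf_mul_schwartz h K (by fun_prop)).aestronglyMeasurable)
      (integrable_bcf_mul_schwartz h K (by fun_prop))
      (integrable_bcf_mul_schwartz h' K (by fun_prop)).aestronglyMeasurable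
      (Eventually.of_forall fun w s _ => ?_)
      (K.integrable.norm.const_mul _)
      (Eventually.of_forall fun w s _ => (hderiv (z + w) s).mul_const _)
    · have h1 : (fun s : ℝ => ∫ w, h (z + w + s • e) * K w) = fun s : ℝ => h (z + s • e) := by
        funext s
        rw [← hh (z + s • e)]
        refine integral_congr_ae (Eventually.of_forall fun w => ?_)
        simp only [add_right_comm]
      have h2 := key.2
      rw [h1] at h2
      have h3 := h2.unique (hderiv z 0)
      simpa using h3
    · rw [norm_mul]
      gcongr
      exact h'.norm_coe_le_norm _
  · exact BoundedContinuousFunction.norm_ofNormedAddCommGroup_le _ (by positivity) hnorm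

lemma hasDerivAt_pow_succ_div_factorial (j : ℕ) (s : ℝ) :
    HasDerivAt (fun s : ℝ => s ^ (j + 1) / (j + 1).factorial) (s ^ j / j.factorial) s := by
  have h := (hasDerivAt_pow (j + 1) s).div_const ((j + 1).factorial : ℝ)
  refine h.congr_deriv ?_
  rw [Nat.factorial_succ]
  push_cast
  field_simp

/-- Taylor's formula for a sequence of functions on the half-line, each the derivative of the
preceding one. -/
lemma norm_sub_taylor_le {φ : ℕ → ℝ → ℂ} {C M : ℝ}
    (hφ : ∀ k s, HasDerivAt (φ k) (φ (k + 1) s) s) (hM : ∀ k s, ‖φ k s‖ ≤ C ^ k * M) (n : ℕ) :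
    ∀ (k : ℕ) (s : ℝ), 0 ≤ s →
      ‖φ k s - ∑ j ∈ Finset.range n, φ (k + j) 0 * ((s ^ j / j.factorial : ℝ) : ℂ)‖
        ≤ C ^ (k + n) * M * (s ^ n / n.factorial) := by
  induction n with
  | zero => intro k s _; simpa using hM k s
  | succ n ih =>
    intro k s hs
    have hd : ∀ t : ℝ, HasDerivAt (fun t => φ k t - ∑ j ∈ Finset.range (n + 1),
        φ (k + j) 0 * ((t ^ j / j.factorial : ℝ) : ℂ))
        (φ (k + 1) t - ∑ j ∈ Finset.range n,
          φ (k + 1 + j) 0 * ((t ^ j / j.factorial : ℝ) : ℂ)) t := by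
      intro t
      simp only [Finset.sum_range_succ' _ n]
      refine (hφ k t).sub ?_
      simp only [pow_zero]
      refine HasDerivAt.add_const _ (HasDerivAt.fun_sum fun j _ => ?_)
      rw [show k + 1 + j = k + (j + 1) by ring]
      exact (hasDerivAt_pow_succ_div_factorial j t).ofReal_comp.const_mul _
    have hB : ∀ t : ℝ, HasDerivAt
        (fun t : ℝ => C ^ (k + (n + 1)) * M * (t ^ (n + 1) / (n + 1).factorial))
        (C ^ (k + (n + 1)) * M * (t ^ n / n.factorial)) t := fun t =>
      (hasDerivAt_pow_succ_div_factorial n t).const_mul _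
    refine image_norm_le_of_norm_deriv_right_le_deriv_boundary (a := 0) (b := s)
      (fun t _ => (hd t).continuousAt.continuousWithinAt)
      (fun t _ => (hd t).hasDerivWithinAt) ?_ hB ?_ ⟨hs, le_rfl⟩
    · rw [Finset.sum_range_succ']
      simp
    · intro t ht
      have := ih (k + 1) t ht.1
      rwa [show k + 1 + n = k + (n + 1) by ring] at this

open LineDeriv in
lemma ReproducedBy.exists_iterated_lineDeriv {K : SchwartzMap ℂ ℂ} (e : ℂ) :
    ∃ C : ℝ, 0 ≤ C ∧ ∀ h : BoundedContinuousFunction ℂ ℂ, ReproducedBy K h →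
      ∃ D : ℕ → BoundedContinuousFunction ℂ ℂ, D 0 = h ∧ (∀ k, ‖D k‖ ≤ C ^ k * ‖h‖) ∧
        ∀ k z (s : ℝ), HasDerivAt (fun s : ℝ => D k (z + s • e)) (D (k + 1) (z + s • e)) s := by
  choose! D hD using fun h (hh : ReproducedBy K h) => hh.exists_lineDeriv e
  refine ⟨∫ w, ‖(∂_{e} K : SchwartzMap ℂ ℂ) w‖, integral_nonneg fun _ => norm_nonneg _,
    fun h hh => ⟨fun k => D^[k] h, rfl, ?_, ?_⟩⟩
  all_goals
    have hr : ∀ k, ReproducedBy K (D^[k] h) := fun k => by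
      induction k with
      | zero => exact hh
      | succ k ih => rw [Function.iterate_succ_apply']; exact (hD _ ih).1
  · intro k
    induction k with
    | zero => simp
    | succ k ih =>
      beta_reduce at ih ⊢
      rw [Function.iterate_succ_apply', pow_succ', mul_assoc]
      exact (hD _ (hr k)).2.1.trans
        (mul_le_mul_of_nonneg_left ih (integral_nonneg fun _ => norm_nonneg _))
  · intro k
    beta_reduce
    rw [Function.iterate_succ_apply']
    exact (hD _ (hr k)).2.2

/-- Functions reproduced by a Schwartz kernel extend to entire functions along every line, with
bounds on a strip. -/
lemma ReproducedBy.exists_entire_extension (K : SchwartzMap ℂ ℂ) (e : ℂ) :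
    ∃ B : ℝ, 0 ≤ B ∧ ∀ h : BoundedContinuousFunction ℂ ℂ, ReproducedBy K h →
      ∃ G : ℂ → ℂ → ℂ, (∀ z, Differentiable ℂ (G z)) ∧
        (∀ z (s : ℝ), G z s = h (z + s • e)) ∧
        (∀ z (s : ℝ) ζ, G z (s + ζ) = G (z + s • e) ζ) ∧
        (∀ z ζ, |ζ.im| ≤ 1 → ‖G z ζ‖ ≤ B * ‖h‖) ∧
        ∀ ζ, Continuous fun z => G z ζ := by
  obtain ⟨C, hC, H⟩ := ReproducedBy.exists_iterated_lineDeriv (K := K) e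
  refine ⟨Real.exp C, (Real.exp_pos C).le, fun h hh => ?_⟩
  obtain ⟨D, hD0, hDn, hDd⟩ := H h hh
  have hterm : ∀ z ζ k, ‖D k z * (ζ ^ k / (k.factorial : ℂ))‖
      ≤ ‖h‖ * ((C * ‖ζ‖) ^ k / k.factorial) := by
    intro z ζ k
    rw [norm_mul, norm_div, norm_pow, Complex.norm_natCast]
    calc ‖D k z‖ * (‖ζ‖ ^ k / k.factorial) ≤ (C ^ k * ‖h‖) * (‖ζ‖ ^ k / k.factorial) := by
          gcongr
          exact ((D k).norm_coe_le_norm z).trans (hDn k)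
      _ = _ := by rw [mul_pow]; ring
  have hsum : ∀ R : ℝ, Summable fun k : ℕ => ‖h‖ * (R ^ k / k.factorial) := fun R =>
    (Real.summable_pow_div_factorial R).mul_left _
  set G : ℂ → ℂ → ℂ := fun z ζ => ∑' k, D k z * (ζ ^ k / (k.factorial : ℂ)) with hG
  have hGdiff : ∀ z, Differentiable ℂ (G z) := by
    intro z ζ
    have := Complex.differentiableOn_tsum_of_summable_norm (U := Metric.ball 0 (‖ζ‖ + 1))
      (F := fun k (ζ : ℂ) => D k z * (ζ ^ k / (k.factorial : ℂ)))
      (hsum (C * (‖ζ‖ + 1))) (fun k => by fun_prop) Metric.isOpen_ball (fun k w hw => ?_)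
    · exact this.differentiableAt (Metric.isOpen_ball.mem_nhds (by simp))
    · refine (hterm z w k).trans ?_
      have : ‖w‖ ≤ ‖ζ‖ + 1 := (mem_ball_zero_iff.1 hw).le
      gcongr
  have hGpos : ∀ z (s : ℝ), 0 ≤ s → G z s = h (z + s • e) := by
    intro z s hs
    have h1 : HasSum (fun k => D k z * ((s : ℂ) ^ k / (k.factorial : ℂ))) (G z s) :=
      (Summable.of_norm_bounded (hsum _) (hterm z s)).hasSum
    have h2 : Tendsto (fun n => ∑ j ∈ Finset.range n, D j z * ((s : ℂ) ^ j / (j.factorial : ℂ)))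
        atTop (nhds (h (z + s • e))) := by
      rw [tendsto_iff_norm_sub_tendsto_zero]
      have h3 : Tendsto (fun n : ℕ => ‖h‖ * ((C * s) ^ n / n.factorial)) atTop (nhds 0) := by
        simpa using (FloorSemiring.tendsto_pow_div_factorial_atTop (C * s)).const_mul ‖h‖
      refine squeeze_zero (fun _ => norm_nonneg _) (fun n => ?_) h3
      have h4 := norm_sub_taylor_le (φ := fun k s => D k (z + s • e)) (C := C) (M := ‖h‖)
        (fun k s => hDd k z s) (fun k s => ((D k).norm_coe_le_norm _).trans (hDn k)) n 0 s hs
      rw [norm_sub_rev]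
      simp only [hD0, zero_add, zero_smul, add_zero] at h4
      push_cast at h4
      refine h4.trans (le_of_eq ?_)
      rw [mul_pow]; ring
    exact tendsto_nhds_unique h1.tendsto_sum_nat h2
  have hfreq : ∀ {F₁ F₂ : ℂ → ℂ}, Differentiable ℂ F₁ → Differentiable ℂ F₂ →
      (∀ t : ℝ, 0 < t → F₁ t = F₂ t) → F₁ = F₂ := by
    intro F₁ F₂ h₁ h₂ h₁₂
    refine AnalyticOnNhd.eq_of_frequently_eq (𝕜 := ℂ) (z₀ := 0)
      (fun z _ => h₁.analyticAt z) (fun z _ => h₂.analyticAt z) ?_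
    have ht : Tendsto (fun t : ℝ => (t : ℂ)) (nhdsWithin 0 (Set.Ioi 0)) (nhdsWithin 0 {0}ᶜ) := by
      refine tendsto_nhdsWithin_iff.2 ⟨?_, ?_⟩
      · exact (Complex.continuous_ofReal.tendsto' 0 0 (by simp)).mono_left nhdsWithin_le_nhds
      · filter_upwards [self_mem_nhdsWithin] with t ht
        simpa using (ne_of_gt ht : t ≠ 0)
    refine ht.frequently (Eventually.frequently ?_)
    filter_upwards [self_mem_nhdsWithin] with t ht using h₁₂ t ht
  have hshift : ∀ z (s : ℝ) ζ, 0 ≤ s → G z (s + ζ) = G (z + s • e) ζ := by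
    intro z s ζ hs
    refine congrFun (hfreq (F₁ := fun ζ => G z (s + ζ)) (F₂ := G (z + s • e))
      ((hGdiff z).comp (by fun_prop)) (hGdiff _) fun t ht => ?_) ζ
    rw [hGpos _ t ht.le, ← Complex.ofReal_add, hGpos z (s + t) (by positivity), add_smul,
      add_assoc]
  have hshift' : ∀ z (s : ℝ) ζ, G z (s + ζ) = G (z + s • e) ζ := by
    intro z s ζ
    rcases le_total 0 s with hs | hs
    · exact hshift z s ζ hs
    · have := hshift (z + s • e) (-s) (s + ζ) (by linarith)
      rw [neg_smul, add_neg_cancel_right] at this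
      rw [← this]
      push_cast
      congr 1
      ring
  refine ⟨G, hGdiff, fun z s => ?_, hshift', fun z ζ hζ => ?_, fun ζ => ?_⟩
  · have h1 := hshift' z s 0
    have h2 := hGpos (z + s • e) 0 le_rfl
    simp only [Complex.ofReal_zero, zero_smul, add_zero] at h1 h2
    rw [h1, h2]
  · have h1 := hshift' z ζ.re (ζ.im * Complex.I)
    rw [Complex.re_add_im] at h1
    have hexp : ∑' k : ℕ, ‖h‖ * (C ^ k / k.factorial) = Real.exp C * ‖h‖ := by
      rw [tsum_mul_left, mul_comm, Real.exp_eq_exp_ℝ, NormedSpace.exp_eq_tsum_div]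
    rw [h1, ← hexp]
    refine tsum_of_norm_bounded (hsum C).hasSum fun k => (hterm _ _ k).trans ?_
    have : ‖(ζ.im * Complex.I : ℂ)‖ ≤ 1 := by simpa using hζ
    gcongr
    exact mul_le_of_le_one_right hC this
  · exact continuous_tsum (fun k => (D k).continuous.mul continuous_const) (hsum _)
      fun k z => hterm z ζ k

lemma sub_ofReal_ne_zero {c : ℝ} (hc : c ^ 2 = 1) (t x : ℝ) :
    (t + c * Complex.I - x : ℂ) ≠ 0 := by
  intro h
  have : c = 0 := by simpa using congrArg Complex.im h
  simp [this] at hc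

lemma sq_norm_inv_sub_ofReal {c : ℝ} (hc : c ^ 2 = 1) (t x : ℝ) :
    ‖(t + c * Complex.I - x : ℂ)⁻¹‖ ^ 2 = (1 + (t - x) ^ 2)⁻¹ := by
  rw [norm_inv, inv_pow, Complex.sq_norm, Complex.normSq_apply]
  simp
  linear_combination hc

lemma integrable_inv_one_add_sub_sq (x : ℝ) : Integrable fun t : ℝ => (1 + (t - x) ^ 2)⁻¹ :=
  integrable_inv_one_add_sq.comp_sub_right x

lemma integral_inv_one_add_sub_sq (x : ℝ) : ∫ t : ℝ, (1 + (t - x) ^ 2)⁻¹ = Real.pi := by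
  rw [integral_sub_right_eq_self (fun t : ℝ => (1 + t ^ 2)⁻¹) x, integral_univ_inv_one_add_sq]

lemma continuous_inv_sub_ofReal {c : ℝ} (hc : c ^ 2 = 1) (x : ℝ) :
    Continuous fun t : ℝ => (t + c * Complex.I - x : ℂ)⁻¹ :=
  Continuous.inv₀ (by fun_prop) fun t => sub_ofReal_ne_zero hc t x

lemma integrable_mul_inv_sub_mul_inv_sub {g : ℝ → ℂ} (hg : Continuous g) {M : ℝ}
    (hM : ∀ t, ‖g t‖ ≤ M) {c : ℝ} (hc : c ^ 2 = 1) (x y : ℝ) (d : ℂ) :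
    Integrable fun t : ℝ =>
      g t * (t + c * Complex.I - x : ℂ)⁻¹ * d * (t + c * Complex.I - y : ℂ)⁻¹ := by
  have hM0 : 0 ≤ M := (norm_nonneg _).trans (hM 0)
  refine Integrable.mono' (g := fun t : ℝ => M * ‖d‖ *
    ((1 + (t - x) ^ 2)⁻¹ + (1 + (t - y) ^ 2)⁻¹))
    (((integrable_inv_one_add_sub_sq x).add (integrable_inv_one_add_sub_sq y)).const_mul _)
    (((hg.mul (continuous_inv_sub_ofReal hc x)).mul continuous_const).mul
      (continuous_inv_sub_ofReal hc y)).aestronglyMeasurable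
    (Eventually.of_forall fun t => ?_)
  rw [norm_mul, norm_mul, norm_mul, ← sq_norm_inv_sub_ofReal hc t x,
    ← sq_norm_inv_sub_ofReal hc t y]
  set a := ‖(t + c * Complex.I - x : ℂ)⁻¹‖
  set b := ‖(t + c * Complex.I - y : ℂ)⁻¹‖
  calc ‖g t‖ * a * ‖d‖ * b = ‖g t‖ * ‖d‖ * (a * b) := by ring
    _ ≤ M * ‖d‖ * (a ^ 2 + b ^ 2) := by
      gcongr
      · exact hM t
      · nlinarith [sq_nonneg (a - b), sq_nonneg a, sq_nonneg b]

/-- If `H` is entire and decays along the vertical sides of the rectangles `[-R, R] × [-1, 1]`,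
the integrals over the two horizontal sides agree in the limit. -/
lemma tendsto_integral_horizontal {H : ℂ → ℂ} (hH : Differentiable ℂ H) {A b : ℝ}
    (hA : ∀ ζ : ℂ, |ζ.im| ≤ 1 → b < |ζ.re| → ‖H ζ‖ ≤ A / (|ζ.re| - b)) :
    Tendsto (fun R : ℝ => ∫ t in -R..R, (H (t + (-1 : ℝ) * Complex.I) -
      H (t + (1 : ℝ) * Complex.I))) atTop (nhds 0) := by
  have hvert : ∀ R : ℝ, 0 < R → b < R → ∀ R' : ℝ, |R'| = R →
      ‖∫ s in (-1 : ℝ)..1, H (R' + s * Complex.I)‖ ≤ A / (R - b) * 2 := by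
    intro R hR hbR R' hR'
    have := intervalIntegral.norm_integral_le_of_norm_le_const (a := -1) (b := 1)
      (f := fun s : ℝ => H (R' + s * Complex.I)) (C := A / (R - b)) (fun s hs => ?_)
    · refine this.trans (le_of_eq ?_)
      norm_num
    · rw [Set.uIoc_of_le (by norm_num)] at hs
      have h1 := hA (R' + s * Complex.I)
      simp only [Complex.add_im, Complex.ofReal_im, Complex.mul_im, Complex.ofReal_re,
        Complex.I_im, Complex.I_re, Complex.add_re, Complex.mul_re, mul_zero, mul_one, add_zero,
        zero_add, sub_zero, hR'] at h1
      exact h1 (abs_le.2 ⟨hs.1.le, hs.2⟩) hbR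
  have hlim : Tendsto (fun R : ℝ => A / (R - b) * 2 + A / (R - b) * 2) atTop (nhds 0) := by
    have h1 : Tendsto (fun R : ℝ => A / (R - b)) atTop (nhds 0) :=
      tendsto_const_nhds.div_atTop (tendsto_atTop_add_const_right _ (-b) tendsto_id)
    simpa using (h1.mul_const 2).add (h1.mul_const 2)
  refine squeeze_zero_norm' ?_ hlim
  filter_upwards [eventually_gt_atTop 0, eventually_gt_atTop b] with R hR hbR
  have hint : ∀ c : ℝ, IntervalIntegrable (fun t : ℝ => H (t + c * Complex.I)) volume (-R) R :=
    fun c => (hH.continuous.comp (by fun_prop)).intervalIntegrable _ _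
  have hrect := Complex.integral_boundary_rect_eq_zero_of_differentiableOn H
    (⟨-R, -1⟩ : ℂ) (⟨R, 1⟩ : ℂ) hH.differentiableOn
  dsimp only at hrect
  rw [intervalIntegral.integral_sub (hint _) (hint _)]
  have h2 : (∫ t in -R..R, H (t + (-1 : ℝ) * Complex.I))
      - ∫ t in -R..R, H (t + (1 : ℝ) * Complex.I)
      = Complex.I • (∫ s in (-1 : ℝ)..1, H ((-R : ℝ) + s * Complex.I))
        - Complex.I • ∫ s in (-1 : ℝ)..1, H (R + s * Complex.I) := by
    linear_combination hrect
  rw [h2]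
  refine (norm_sub_le _ _).trans ?_
  rw [norm_smul, norm_smul, Complex.norm_I, one_mul, one_mul]
  exact add_le_add (hvert R hR hbR (-R) (by rw [abs_neg, abs_of_pos hR]))
    (hvert R hR hbR R (abs_of_pos hR))

/-- Cauchy's formula on the strip `|Im ζ| ≤ 1` for the divided difference of a bounded
holomorphic function. -/
lemma integral_strip_sub {F : ℂ → ℂ} (hF : Differentiable ℂ F) {M : ℝ}
    (hM : ∀ ζ : ℂ, |ζ.im| ≤ 1 → ‖F ζ‖ ≤ M) (x y : ℝ) :
    (∫ t : ℝ, F (t + (-1 : ℝ) * Complex.I) * (t + (-1 : ℝ) * Complex.I - x : ℂ)⁻¹ * (x - y) *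
        (t + (-1 : ℝ) * Complex.I - y : ℂ)⁻¹) -
      (∫ t : ℝ, F (t + (1 : ℝ) * Complex.I) * (t + (1 : ℝ) * Complex.I - x : ℂ)⁻¹ * (x - y) *
        (t + (1 : ℝ) * Complex.I - y : ℂ)⁻¹) = 2 * Real.pi * Complex.I * (F x - F y) := by
  rcases eq_or_ne x y with rfl | hxy
  · simp
  have hxy' : (x - y : ℂ) ≠ 0 := sub_ne_zero.2 (by exact_mod_cast hxy)
  have hcm : ((-1 : ℝ)) ^ 2 = 1 := by norm_num
  have hcp : ((1 : ℝ)) ^ 2 = 1 := by norm_num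
  set H : ℂ → ℂ := dslope (dslope F x) y with hHdef
  have hdx : Differentiable ℂ (dslope F x) := by
    rw [← differentiableOn_univ, Complex.differentiableOn_dslope univ_mem, differentiableOn_univ]
    exact hF
  have hH : Differentiable ℂ H := by
    rw [← differentiableOn_univ, Complex.differentiableOn_dslope univ_mem, differentiableOn_univ]
    exact hdx
  set D : ℂ := (F y - F x) / (y - x) with hD
  have hHval : ∀ ζ : ℂ, ζ - x ≠ 0 → ζ - y ≠ 0 →
      H ζ = (ζ - y)⁻¹ * ((ζ - x)⁻¹ * (F ζ - F x) - D) := by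
    intro ζ h1 h2
    rw [hHdef, dslope_of_ne _ (sub_ne_zero.1 h2), slope_def_module,
      dslope_of_ne _ (sub_ne_zero.1 h1), dslope_of_ne _ (by exact_mod_cast hxy.symm), slope_def_module, slope_def_module, smul_eq_mul,
      smul_eq_mul, smul_eq_mul, hD, div_eq_inv_mul]
  have hM0 : 0 ≤ M := (norm_nonneg _).trans (hM 0 (by simp))
  have hdecay : ∀ ζ : ℂ, |ζ.im| ≤ 1 → |x| + |y| + 1 < |ζ.re| →
      ‖H ζ‖ ≤ (2 * M + ‖D‖) / (|ζ.re| - (|x| + |y| + 1)) := by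
    intro ζ h1 h2
    have hsub : ∀ u : ℝ, |ζ.re| - |u| ≤ ‖ζ - u‖ := fun u => by
      have h3 := Complex.abs_re_le_norm (ζ - u)
      have h4 := abs_sub_abs_le_abs_sub ζ.re u
      simp only [Complex.sub_re, Complex.ofReal_re] at h3
      linarith
    have hx1 : 1 ≤ ‖ζ - x‖ := by linarith [hsub x, abs_nonneg y]
    have hy1 : |ζ.re| - (|x| + |y| + 1) ≤ ‖ζ - y‖ := by linarith [hsub y, abs_nonneg x]
    have hpos : 0 < |ζ.re| - (|x| + |y| + 1) := by linarith
    rw [hHval ζ (norm_pos_iff.1 (by linarith)) (norm_pos_iff.1 (by linarith)), norm_mul, norm_inv,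
      div_eq_inv_mul]
    have h5 : ‖F ζ - F x‖ ≤ 2 * M := by
      have := norm_sub_le (F ζ) (F x)
      have := hM ζ h1
      have := hM x (by simp)
      linarith
    have h6 : ‖(ζ - x)⁻¹ * (F ζ - F x) - D‖ ≤ 2 * M + ‖D‖ := by
      refine (norm_sub_le _ _).trans ?_
      rw [norm_mul, norm_inv]
      have : ‖ζ - x‖⁻¹ ≤ 1 := inv_le_one_of_one_le₀ hx1
      have := mul_le_mul this h5 (norm_nonneg _) zero_le_one
      linarith
    gcongr
  have hlim := tendsto_integral_horizontal hH hdecay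
  set A : ℝ → ℝ → ℂ := fun c t => F (t + c * Complex.I) * (t + c * Complex.I - x : ℂ)⁻¹ *
    (x - y) * (t + c * Complex.I - y : ℂ)⁻¹ with hAdef
  have hAint : ∀ c : ℝ, c ^ 2 = 1 → Integrable (A c) := fun c hc => by
    refine integrable_mul_inv_sub_mul_inv_sub (g := fun t : ℝ => F (t + c * Complex.I))
      (hF.continuous.comp (by fun_prop)) (M := M) (fun t => hM _ ?_) hc x y (x - y)
    have : |c| = 1 := (pow_eq_one_iff_of_nonneg (abs_nonneg c) two_ne_zero).1 (by rw [sq_abs, hc])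
    simp [this]
  obtain ⟨P, hPdef⟩ : ∃ P : ℝ → ℝ → ℂ,
      P = fun u t => 2 * Complex.I * (((1 + (t - u) ^ 2)⁻¹ : ℝ) : ℂ) := ⟨_, rfl⟩
  have hPint : ∀ u, Integrable (P u) := fun u => hPdef ▸
    (integrable_inv_one_add_sub_sq u).ofReal.const_mul _
  have hPval : ∀ u, ∫ t, P u t = 2 * Real.pi * Complex.I := fun u => by
    rw [hPdef, integral_const_mul, integral_complex_ofReal, integral_inv_one_add_sub_sq]
    ring
  have hP : ∀ u t : ℝ, P u t = (t + (-1 : ℝ) * Complex.I - u : ℂ)⁻¹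
      - (t + (1 : ℝ) * Complex.I - u : ℂ)⁻¹ := by
    intro u t
    have h1 := sub_ofReal_ne_zero hcm t u
    have h2 := sub_ofReal_ne_zero hcp t u
    have h3 : ((1 + (t - u) ^ 2 : ℝ) : ℂ) ≠ 0 := by
      have : (1 + (t - u) ^ 2 : ℝ) ≠ 0 := by positivity
      exact_mod_cast this
    have h4 : ((1 + (t - u) ^ 2 : ℝ) : ℂ) = (t + (-1 : ℝ) * Complex.I - u : ℂ)
        * (t + (1 : ℝ) * Complex.I - u : ℂ) := by
      push_cast
      linear_combination Complex.I_sq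
    rw [hPdef]
    dsimp only
    rw [Complex.ofReal_inv, h4]
    rw [inv_sub_inv h1 h2, ← div_eq_mul_inv]
    congr 1
    push_cast
    ring
  have hN : ∀ t : ℝ, H (t + (-1 : ℝ) * Complex.I) - H (t + (1 : ℝ) * Complex.I)
      = (x - y : ℂ)⁻¹ * (A (-1) t - A 1 t - F x * P x t + F y * P y t) := by
    intro t
    have h1 := sub_ofReal_ne_zero hcm t x
    have h2 := sub_ofReal_ne_zero hcp t x
    have h3 := sub_ofReal_ne_zero hcm t y
    have h4 := sub_ofReal_ne_zero hcp t y
    have hyx : (y - x : ℂ) ≠ 0 := by rw [← neg_sub]; exact neg_ne_zero.2 hxy'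
    have hone : ∀ w : ℂ, w - x ≠ 0 → w - y ≠ 0 → (w - y)⁻¹ * ((w - x)⁻¹ * (F w - F x) - D)
        = (x - y : ℂ)⁻¹ * (F w * (w - x)⁻¹ * (x - y) * (w - y)⁻¹ - F x * (w - x)⁻¹
          + F y * (w - y)⁻¹) := by
      intro w hwx hwy
      have hD' : D = (F x - F y) / (x - y) := by
        rw [hD, ← neg_sub (F x), ← neg_sub (x : ℂ), neg_div_neg_eq]
      rw [hD']
      field_simp
      ring
    rw [hHval _ h1 h3, hHval _ h2 h4, hP, hP, hone _ h1 h3, hone _ h2 h4]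
    ring
  simp_rw [hN] at hlim
  have hNint : Integrable fun t : ℝ =>
      (x - y : ℂ)⁻¹ * (A (-1) t - A 1 t - F x * P x t + F y * P y t) :=
    ((((hAint _ hcm).sub (hAint _ hcp)).sub ((hPint x).const_mul _)).add
      ((hPint y).const_mul _)).const_mul _
  have hlim2 := intervalIntegral_tendsto_integral hNint tendsto_neg_atTop_atBot tendsto_id
  have hzero := tendsto_nhds_unique hlim2 hlim
  rw [integral_const_mul, integral_add, integral_sub, integral_sub (hAint _ hcm) (hAint _ hcp),
    integral_const_mul, integral_const_mul, hPval, hPval, mul_eq_zero] at hzero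
  · have h0 := hzero.resolve_left (inv_ne_zero hxy')
    linear_combination h0
  · exact (hAint _ hcm).sub (hAint _ hcp)
  · exact (hPint x).const_mul _
  · exact ((hAint _ hcm).sub (hAint _ hcp)).sub ((hPint x).const_mul _)
  · exact (hPint y).const_mul _

/-! ### Sampling a bilinear form on pairs of continuous functions -/

/-- A partition of unity on a compact metric space, subordinate to balls of radius `ε` and indexed
by their centers. -/
lemma exists_partition_of_unity_balls (X : Type*) [MetricSpace X] [CompactSpace X] {ε : ℝ}
    (hε : 0 < ε) :
    ∃ (s : Finset X) (χ : X → C(X, ℝ)), (∀ i x, 0 ≤ χ i x) ∧ (∀ x, ∑ i ∈ s, χ i x = 1) ∧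
      ∀ i x, χ i x ≠ 0 → dist x i < ε := by
  obtain ⟨t, -, ht, hcov⟩ := (isCompact_univ : IsCompact (Set.univ : Set X)).finite_cover_balls hε
  let w : X → X → ℝ := fun i x => max 0 (ε - dist x i)
  have hw0 : ∀ i x, 0 ≤ w i x := fun i x => le_max_left _ _
  have hwc : ∀ i, Continuous (w i) := fun i => by fun_prop
  have hpos : ∀ x, 0 < ∑ i ∈ ht.toFinset, w i x := fun x => by
    obtain ⟨i, hi, hxi⟩ := Set.mem_iUnion₂.1 (hcov (Set.mem_univ x))
    refine Finset.sum_pos' (fun i _ => hw0 i x) ⟨i, ht.mem_toFinset.2 hi, ?_⟩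
    exact lt_max_of_lt_right (sub_pos.2 (Metric.mem_ball.1 hxi))
  refine ⟨ht.toFinset, fun i => ⟨fun x => w i x / ∑ j ∈ ht.toFinset, w j x,
    (hwc i).div (continuous_finsetSum _ fun j _ => hwc j) fun x => (hpos x).ne'⟩,
    fun i x => div_nonneg (hw0 i x) (hpos x).le, fun x => ?_, fun i x h => ?_⟩
  · simp only [ContinuousMap.coe_mk]
    rw [← Finset.sum_div, div_self (hpos x).ne']
  · by_contra! hd
    exact h (by simp [w, max_eq_left (sub_nonpos.2 hd)])

lemma exists_sampling (X : Type*) [MetricSpace X] [CompactSpace X] :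
    ∃ (s : ℕ → Finset X) (χ : ℕ → X → C(X, ℂ)),
      (∀ (n : ℕ) (a : C(X, ℂ)), ‖∑ i ∈ s n, a i • χ n i‖ ≤ ‖a‖) ∧
      ∀ a : C(X, ℂ), Tendsto (fun n => ∑ i ∈ s n, a i • χ n i) atTop (nhds a) := by
  choose s χ h0 h1 hsupp using fun n : ℕ =>
    exists_partition_of_unity_balls X (Nat.one_div_pos_of_nat (α := ℝ) (n := n))
  have hsum : ∀ (n : ℕ) (b : X → ℂ) (x : X) (r : ℝ),
      (∀ i, dist x i < 1 / ((n : ℝ) + 1) → ‖b i‖ ≤ r) →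
      ‖∑ i ∈ s n, b i * (χ n i x : ℂ)‖ ≤ r := by
    intro n b x r hb
    calc ‖∑ i ∈ s n, b i * (χ n i x : ℂ)‖ ≤ ∑ i ∈ s n, r * χ n i x := by
          refine norm_sum_le_of_le _ fun i _ => ?_
          rw [norm_mul, Complex.norm_real, Real.norm_of_nonneg (h0 n i x)]
          rcases eq_or_ne (χ n i x) 0 with h | h
          · simp [h]
          · exact mul_le_mul_of_nonneg_right (hb i (hsupp n i x h)) (h0 n i x)
      _ = r := by rw [← Finset.mul_sum, h1, mul_one]
  refine ⟨s, fun n i => ⟨fun x => (χ n i x : ℂ), by fun_prop⟩, fun n a => ?_, fun a => ?_⟩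
  · refine (ContinuousMap.norm_le _ (norm_nonneg a)).2 fun x => ?_
    simpa using hsum n a x ‖a‖ fun i _ => a.norm_coe_le_norm i
  · rw [Metric.tendsto_atTop]
    intro η hη
    obtain ⟨δ, hδ, hunif⟩ := Metric.uniformContinuous_iff.1
      (CompactSpace.uniformContinuous_of_continuous a.continuous) (η / 2) (half_pos hη)
    obtain ⟨n₀, hn₀⟩ := exists_nat_one_div_lt hδ
    refine ⟨n₀, fun n hn => ?_⟩
    rw [dist_eq_norm]
    refine lt_of_le_of_lt ((ContinuousMap.norm_le _ (half_pos hη).le).2 fun x => ?_)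
      (half_lt_self hη)
    have hx : (∑ i ∈ s n, a i * (χ n i x : ℂ)) - a x
        = ∑ i ∈ s n, (a i - a x) * (χ n i x : ℂ) := by
      simp_rw [sub_mul]
      rw [Finset.sum_sub_distrib, ← Finset.mul_sum, ← Complex.ofReal_sum, h1, Complex.ofReal_one,
        mul_one]
    have := hsum n (fun i => a i - a x) x (η / 2) fun i hi => by
      rw [← dist_eq_norm, dist_comm]
      refine (hunif (hi.trans_le ((Nat.one_div_le_one_div hn).trans hn₀.le))).le
    rw [← hx] at this
    simpa using this

section Sampling

variable {X Y : Type*} [MetricSpace X] [MetricSpace Y]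
  (β : C(X, ℂ) →L[ℂ] C(Y, ℂ) →L[ℂ] ℂ) {s : ℕ → Finset X} {χ : ℕ → X → C(X, ℂ)}

/-- The value `V` of the bilinear form `β` on a kernel `k`, computed by sampling the first
variable. -/
def HasSampledValue (s : ℕ → Finset X) (χ : ℕ → X → C(X, ℂ)) (k : X → C(Y, ℂ)) (V : ℂ) : Prop :=
  Tendsto (fun n => ∑ i ∈ s n, β (χ n i) (k i)) atTop (nhds V)

lemma sum_sampling (n : ℕ) (a : C(X, ℂ)) (b : C(Y, ℂ)) :
    ∑ i ∈ s n, β (χ n i) (a i • b) = β (∑ i ∈ s n, a i • χ n i) b := by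
  simp

variable {β}

lemma HasSampledValue.sub {k k' : X → C(Y, ℂ)} {V V' : ℂ} (h : HasSampledValue β s χ k V)
    (h' : HasSampledValue β s χ k' V') :
    HasSampledValue β s χ (fun x => k x - k' x) (V - V') := by
  simpa [HasSampledValue] using Tendsto.sub h h'

lemma HasSampledValue.add {k k' : X → C(Y, ℂ)} {V V' : ℂ} (h : HasSampledValue β s χ k V)
    (h' : HasSampledValue β s χ k' V') :
    HasSampledValue β s χ (fun x => k x + k' x) (V + V') := by
  simpa [HasSampledValue, Finset.sum_add_distrib] using Tendsto.add h h'

lemma HasSampledValue.const_smul {k : X → C(Y, ℂ)} {V : ℂ} (h : HasSampledValue β s χ k V)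
    (c : ℂ) : HasSampledValue β s χ (fun x => c • k x) (c * V) := by
  simpa [HasSampledValue, Finset.mul_sum] using Tendsto.const_mul c h

variable [CompactSpace X] [CompactSpace Y]

lemma hasSampledValue_smul
    (hlim : ∀ a : C(X, ℂ), Tendsto (fun n => ∑ i ∈ s n, a i • χ n i) atTop (nhds a))
    (a : C(X, ℂ)) (b : C(Y, ℂ)) : HasSampledValue β s χ (fun x => a x • b) (β a b) := by
  unfold HasSampledValue
  simp_rw [sum_sampling]
  exact ((β.flip b).continuous.tendsto a).comp (hlim a)

lemma integrable_smul_of_norm_mul {a : ℝ → C(X, ℂ)} {b : ℝ → C(Y, ℂ)} (ha : Continuous a)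
    (hb : Continuous b) (hab : Integrable fun t => ‖a t‖ * ‖b t‖) (x : X) :
    Integrable fun t => a t x • b t := by
  refine hab.mono' (Continuous.aestronglyMeasurable ?_) (Eventually.of_forall fun t => ?_)
  · exact ((continuous_eval_const x).comp ha).smul hb
  · rw [norm_smul]
    gcongr
    exact (a t).norm_coe_le_norm x

lemma hasSampledValue_integral
    (hbd : ∀ (n : ℕ) (a : C(X, ℂ)), ‖∑ i ∈ s n, a i • χ n i‖ ≤ ‖a‖)
    (hlim : ∀ a : C(X, ℂ), Tendsto (fun n => ∑ i ∈ s n, a i • χ n i) atTop (nhds a))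
    {a : ℝ → C(X, ℂ)} {b : ℝ → C(Y, ℂ)} (ha : Continuous a) (hb : Continuous b)
    (hab : Integrable fun t => ‖a t‖ * ‖b t‖) :
    HasSampledValue β s χ (fun x => ∫ t, a t x • b t) (∫ t, β (a t) (b t)) := by
  have hint : ∀ x, Integrable fun t => a t x • b t := integrable_smul_of_norm_mul ha hb hab
  have h1 : ∀ n, ∑ i ∈ s n, β (χ n i) (∫ t, a t i • b t)
      = ∫ t, β (∑ i ∈ s n, a t i • χ n i) (b t) := fun n => by
    simp_rw [← sum_sampling]
    rw [integral_finsetSum _ fun i _ => (β (χ n i)).integrable_comp (hint i)]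
    exact Finset.sum_congr rfl fun i _ => ((β (χ n i)).integral_comp_comm (hint i)).symm
  unfold HasSampledValue
  simp_rw [h1]
  have hevc : ∀ i : X, Continuous fun t => a t i := fun i =>
    (continuous_eval_const i).comp ha
  refine tendsto_integral_of_dominated_convergence (fun t => ‖β‖ * (‖a t‖ * ‖b t‖))
    (fun n => Continuous.aestronglyMeasurable ?_) (hab.const_mul _)
    (fun n => Eventually.of_forall fun t => ?_) (Eventually.of_forall fun t => ?_)
  · exact (β.continuous.comp (continuous_finsetSum _ fun i _ =>
      (hevc i).smul continuous_const)).clm_apply hb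
  · refine (β.le_opNorm₂ _ _).trans ?_
    rw [mul_assoc]
    gcongr
    exact hbd n (a t)
  · exact ((β.flip (b t)).continuous.tendsto (a t)).comp (hlim (a t))

end Sampling

/-! ### Resolvents of real functions -/

section Resolvent

variable {X : Type*} [TopologicalSpace X]

/-- The functions `x ↦ (t + c i - q x)⁻¹`, depending continuously on `t`. -/
noncomputable def resolventMap {c : ℝ} (hc : c ^ 2 = 1) (q : C(X, ℝ)) : C(ℝ, C(X, ℂ)) :=
  ContinuousMap.curry ⟨fun p : ℝ × X => (p.1 + c * Complex.I - q p.2 : ℂ)⁻¹,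
    Continuous.inv₀ (by fun_prop) fun p => sub_ofReal_ne_zero hc p.1 (q p.2)⟩

lemma resolventMap_apply {c : ℝ} (hc : c ^ 2 = 1) (q : C(X, ℝ)) (t : ℝ) (x : X) :
    resolventMap hc q t x = (t + c * Complex.I - q x : ℂ)⁻¹ := rfl

variable [CompactSpace X]

lemma sq_norm_resolventMap_le {c : ℝ} (hc : c ^ 2 = 1) (q : C(X, ℝ)) (t : ℝ) :
    ‖resolventMap hc q t‖ ^ 2 ≤ 2 * (1 + ‖q‖ ^ 2) * (1 + t ^ 2)⁻¹ := by
  have h0 : 0 ≤ 2 * (1 + ‖q‖ ^ 2) * (1 + t ^ 2)⁻¹ := by positivity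
  rw [← Real.le_sqrt (norm_nonneg _) h0, ContinuousMap.norm_le _ (Real.sqrt_nonneg _)]
  intro x
  rw [Real.le_sqrt (norm_nonneg _) h0, resolventMap_apply, sq_norm_inv_sub_ofReal hc,
    ← div_eq_mul_inv, inv_eq_one_div, div_le_div_iff₀ (by positivity) (by positivity)]
  have hq : q x ^ 2 ≤ ‖q‖ ^ 2 := by
    rw [← sq_abs]
    exact pow_le_pow_left₀ (abs_nonneg _) (q.norm_coe_le_norm x) 2
  nlinarith [sq_nonneg (t - 2 * q x), mul_nonneg (sq_nonneg ‖q‖) (sq_nonneg (t - q x))]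

lemma integrable_sq_norm_resolventMap {c : ℝ} (hc : c ^ 2 = 1) (q : C(X, ℝ)) :
    Integrable fun t => ‖resolventMap hc q t‖ ^ 2 := by
  refine (integrable_inv_one_add_sq.const_mul (2 * (1 + ‖q‖ ^ 2))).mono'
    (((resolventMap hc q).continuous.norm.pow 2).aestronglyMeasurable)
    (Eventually.of_forall fun t => ?_)
  rw [Real.norm_of_nonneg (by positivity)]
  exact sq_norm_resolventMap_le hc q t

lemma integral_star_mul_resolventMap {c : ℝ} (hc : c ^ 2 = 1) (q : C(X, ℝ)) :
    (Integrable fun t => star (resolventMap hc q t) * resolventMap hc q t) ∧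
      ∫ t, star (resolventMap hc q t) * resolventMap hc q t = (Real.pi : ℂ) • 1 := by
  have hint : Integrable fun t => star (resolventMap hc q t) * resolventMap hc q t := by
    refine (integrable_sq_norm_resolventMap hc q).mono' (Continuous.aestronglyMeasurable ?_)
      (Eventually.of_forall fun t => ?_)
    · exact (resolventMap hc q).continuous.star.mul (resolventMap hc q).continuous
    · rw [CStarRing.norm_star_mul_self, sq]
  refine ⟨hint, ?_⟩
  ext x
  rw [ContinuousMap.integral_apply hint]
  have : ∀ t : ℝ, (star (resolventMap hc q t) * resolventMap hc q t) x
      = (((1 + (t - q x) ^ 2)⁻¹ : ℝ) : ℂ) := fun t => by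
    rw [ContinuousMap.mul_apply, ContinuousMap.star_apply, resolventMap_apply,
      ← sq_norm_inv_sub_ofReal hc t (q x), Complex.star_def, Complex.conj_mul']
    push_cast
    rfl
  simp_rw [this]
  rw [integral_complex_ofReal, integral_inv_one_add_sub_sq]
  simp

end Resolvent

/-! ### The perturbation formula for homomorphisms into bounded operators -/

section Operators

variable {H : Type*} [NormedAddCommGroup H] [InnerProductSpace ℂ H] [CompleteSpace H]

lemma norm_starAlgHom_apply_le {X : Type*} [TopologicalSpace X] [CompactSpace X]
    (φ : C(X, ℂ) →⋆ₐ[ℂ] (H →L[ℂ] H)) (g : C(X, ℂ)) : ‖φ g‖ ≤ ‖g‖ :=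
  NonUnitalStarAlgHom.norm_apply_le φ g

/-- A `*`-homomorphism from `C(X, ℂ)` to the bounded operators, as a continuous linear map. -/
noncomputable def starAlgHomCLM {X : Type*} [TopologicalSpace X] [CompactSpace X]
    (φ : C(X, ℂ) →⋆ₐ[ℂ] (H →L[ℂ] H)) : C(X, ℂ) →L[ℂ] (H →L[ℂ] H) :=
  LinearMap.mkContinuous φ.toAlgHom.toLinearMap 1 fun g => by
    simpa using norm_starAlgHom_apply_le φ g

lemma inner_starAlgHom_left {X : Type*} [TopologicalSpace X] [CompactSpace X]
    (φ : C(X, ℂ) →⋆ₐ[ℂ] (H →L[ℂ] H)) (g : C(X, ℂ)) (u v : H) :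
    inner ℂ (φ (star g) v) u = inner ℂ v (φ g u) := by
  rw [map_star, ContinuousLinearMap.star_eq_adjoint, ContinuousLinearMap.adjoint_inner_left]

lemma sq_norm_starAlgHom_apply {X : Type*} [TopologicalSpace X] [CompactSpace X]
    (φ : C(X, ℂ) →⋆ₐ[ℂ] (H →L[ℂ] H)) (g : C(X, ℂ)) (u : H) :
    ((‖φ g u‖ ^ 2 : ℝ) : ℂ) = inner ℂ u (φ (star g * g) u) := by
  rw [map_mul, mul_apply_eq_comp, ← inner_starAlgHom_left, star_star,
    inner_self_eq_norm_sq_to_K]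
  push_cast
  rfl

lemma norm_starAlgHom_star_apply {X : Type*} [TopologicalSpace X] [CompactSpace X]
    (φ : C(X, ℂ) →⋆ₐ[ℂ] (H →L[ℂ] H)) (g : C(X, ℂ)) (u : H) : ‖φ (star g) u‖ = ‖φ g u‖ := by
  have h : ((‖φ (star g) u‖ ^ 2 : ℝ) : ℂ) = ((‖φ g u‖ ^ 2 : ℝ) : ℂ) := by
    rw [sq_norm_starAlgHom_apply, sq_norm_starAlgHom_apply, star_star, mul_comm]
  exact (pow_left_inj₀ (norm_nonneg _) (norm_nonneg _) two_ne_zero).1 (by exact_mod_cast h)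

lemma integral_sq_norm_resolventMap {X : Type*} [TopologicalSpace X] [CompactSpace X]
    (φ : C(X, ℂ) →⋆ₐ[ℂ] (H →L[ℂ] H)) {c : ℝ} (hc : c ^ 2 = 1) (q : C(X, ℝ)) (u : H) :
    (Integrable fun t => ‖φ (resolventMap hc q t) u‖ ^ 2) ∧
      ∫ t, ‖φ (resolventMap hc q t) u‖ ^ 2 = Real.pi * ‖u‖ ^ 2 := by
  obtain ⟨hint, hval⟩ := integral_star_mul_resolventMap hc q
  let L : C(X, ℂ) →L[ℂ] ℂ :=
    (innerSL ℂ u).comp ((ContinuousLinearMap.apply ℂ H u).comp (starAlgHomCLM φ))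
  have hL : ∀ g, L g = inner ℂ u (φ g u) := fun g => rfl
  have hpt : ∀ t, L (star (resolventMap hc q t) * resolventMap hc q t)
      = ((‖φ (resolventMap hc q t) u‖ ^ 2 : ℝ) : ℂ) := fun t => by
    rw [hL, sq_norm_starAlgHom_apply]
  have h1 := L.integrable_comp hint
  have h2 := L.integral_comp_comm hint
  simp_rw [hpt] at h1 h2
  refine ⟨by simpa only [RCLike.re_eq_complex_re, Complex.ofReal_re] using h1.re, ?_⟩
  rw [integral_complex_ofReal, hval, map_smul, hL, map_one, one_apply_eq_self,
    inner_self_eq_norm_sq_to_K, smul_eq_mul] at h2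
  apply Complex.ofReal_injective
  rw [h2]
  push_cast
  rfl

variable {X Y : Type*} [MetricSpace X] [CompactSpace X] [MetricSpace Y] [CompactSpace Y]
  (φ : C(X, ℂ) →⋆ₐ[ℂ] (H →L[ℂ] H)) (ψ : C(Y, ℂ) →⋆ₐ[ℂ] (H →L[ℂ] H)) (u v : H)

/-- The bilinear form `(g, k) ↦ ⟪v, φ(g) ψ(k) u⟫`. -/
noncomputable def matrixCoefficient : C(X, ℂ) →L[ℂ] C(Y, ℂ) →L[ℂ] ℂ :=
  LinearMap.mkContinuous₂
    (LinearMap.mk₂ ℂ (fun g k => inner ℂ v (φ g (ψ k u)))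
      (fun g g' k => by rw [map_add, add_apply, inner_add_right])
      (fun r g k => by rw [map_smul, smul_apply, inner_smul_right, smul_eq_mul])
      (fun g k k' => by
        rw [map_add, add_apply, map_add, inner_add_right])
      (fun r g k => by
        rw [map_smul, smul_apply, map_smul, inner_smul_right, smul_eq_mul]))
    (‖v‖ * ‖u‖) fun g k => by
      calc ‖inner ℂ v (φ g (ψ k u))‖ ≤ ‖v‖ * (‖φ g‖ * (‖ψ k‖ * ‖u‖)) := by
            refine (norm_inner_le_norm _ _).trans ?_
            gcongr
            refine ((φ g).le_opNorm _).trans ?_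
            gcongr
            exact (ψ k).le_opNorm _
        _ ≤ ‖v‖ * (‖g‖ * (‖k‖ * ‖u‖)) := by
            gcongr
            · exact norm_starAlgHom_apply_le φ g
            · exact norm_starAlgHom_apply_le ψ k
        _ = ‖v‖ * ‖u‖ * ‖g‖ * ‖k‖ := by ring

lemma matrixCoefficient_apply (g : C(X, ℂ)) (k : C(Y, ℂ)) :
    matrixCoefficient φ ψ u v g k = inner ℂ v (φ g (ψ k u)) := rfl

/-- A real continuous function, as a complex one. -/
def ofRealMap {X : Type*} [TopologicalSpace X] (q : C(X, ℝ)) : C(X, ℂ) :=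
  ⟨fun x => (q x : ℂ), by fun_prop⟩

lemma norm_inner_resolventMap_le {p : C(X, ℂ)} {r : C(Y, ℂ)} {M₁ M₂ : ℝ} (hp : ‖p‖ ≤ M₁)
    (hr : ‖r‖ ≤ M₂) (ρ₁ : C(X, ℂ)) (ρ₂ : C(Y, ℂ)) (D : H →L[ℂ] H) :
    ‖inner ℂ v (φ (p * ρ₁) (D (ψ (ρ₂ * r) u)))‖ ≤
      M₁ * M₂ * ‖D‖ * ((‖φ ρ₁ v‖ ^ 2 + ‖ψ ρ₂ u‖ ^ 2) / 2) := by
  have hM₁ : 0 ≤ M₁ := (norm_nonneg _).trans hp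
  have hM₂ : 0 ≤ M₂ := (norm_nonneg _).trans hr
  rw [mul_comm p, mul_comm ρ₂, map_mul, map_mul, mul_apply_eq_comp,
    mul_apply_eq_comp, ← inner_starAlgHom_left]
  calc ‖inner ℂ (φ (star ρ₁) v) (φ p (D (ψ r (ψ ρ₂ u))))‖
      ≤ ‖φ ρ₁ v‖ * (M₁ * (‖D‖ * (M₂ * ‖ψ ρ₂ u‖))) := by
        rw [← norm_starAlgHom_star_apply φ ρ₁]
        refine (norm_inner_le_norm _ _).trans ?_
        gcongr
        refine ((φ p).le_opNorm _).trans ?_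
        gcongr
        · exact (norm_starAlgHom_apply_le φ p).trans hp
        refine (D.le_opNorm _).trans ?_
        gcongr
        refine ((ψ r).le_opNorm _).trans ?_
        gcongr
        exact (norm_starAlgHom_apply_le ψ r).trans hr
    _ = M₁ * M₂ * ‖D‖ * (‖φ ρ₁ v‖ * ‖ψ ρ₂ u‖) := by ring
    _ ≤ _ := by
        gcongr
        nlinarith [sq_nonneg (‖φ ρ₁ v‖ - ‖ψ ρ₂ u‖)]

/-- The integral over one horizontal line in the strip formula, with its matrix coefficient. -/
lemma exists_hasSampledValue_line {s : ℕ → Finset X} {χ : ℕ → X → C(X, ℂ)}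
    (hbd : ∀ (n : ℕ) (a : C(X, ℂ)), ‖∑ i ∈ s n, a i • χ n i‖ ≤ ‖a‖)
    (hlim : ∀ a : C(X, ℂ), Tendsto (fun n => ∑ i ∈ s n, a i • χ n i) atTop (nhds a))
    {c : ℝ} (hc : c ^ 2 = 1) (q₁ : C(X, ℝ)) (q₂ : C(Y, ℝ)) (p : C(ℝ, C(X, ℂ)))
    (r : C(ℝ, C(Y, ℂ))) {M₁ M₂ : ℝ} (hp : ∀ t, ‖p t‖ ≤ M₁) (hr : ∀ t, ‖r t‖ ≤ M₂) :
    ∃ (k : X → C(Y, ℂ)) (V : ℂ), HasSampledValue (matrixCoefficient φ ψ u v) s χ k V ∧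
      ‖V‖ ≤ Real.pi * (M₁ * M₂ * ‖φ (ofRealMap q₁) - ψ (ofRealMap q₂)‖ *
        ((‖u‖ ^ 2 + ‖v‖ ^ 2) / 2)) ∧
      ∀ x y, k x y = ∫ t : ℝ, p t x * (t + c * Complex.I - q₁ x : ℂ)⁻¹ * (q₁ x - q₂ y) *
        (t + c * Complex.I - q₂ y : ℂ)⁻¹ * r t y := by
  set ρ₁ := resolventMap hc q₁ with hρ₁
  set ρ₂ := resolventMap hc q₂ with hρ₂
  set D := φ (ofRealMap q₁) - ψ (ofRealMap q₂) with hD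
  have hM₁ : 0 ≤ M₁ := (norm_nonneg _).trans (hp 0)
  have hM₂ : 0 ≤ M₂ := (norm_nonneg _).trans (hr 0)
  have ha : Continuous fun t => p t * ρ₁ t := p.continuous.mul ρ₁.continuous
  have hb : Continuous fun t => ρ₂ t * r t := ρ₂.continuous.mul r.continuous
  have ha' : Continuous fun t => p t * ρ₁ t * ofRealMap q₁ := ha.mul continuous_const
  have hb' : Continuous fun t => ofRealMap q₂ * (ρ₂ t * r t) := continuous_const.mul hb
  have hprod : ∀ t, ‖p t * ρ₁ t‖ * ‖ρ₂ t * r t‖ ≤ M₁ * M₂ * (‖ρ₁ t‖ ^ 2 + ‖ρ₂ t‖ ^ 2) := fun t => by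
    calc ‖p t * ρ₁ t‖ * ‖ρ₂ t * r t‖ ≤ (M₁ * ‖ρ₁ t‖) * (‖ρ₂ t‖ * M₂) := by
          gcongr
          · exact (norm_mul_le _ _).trans (by gcongr; exact hp t)
          · exact (norm_mul_le _ _).trans (by gcongr; exact hr t)
      _ = M₁ * M₂ * (‖ρ₁ t‖ * ‖ρ₂ t‖) := by ring
      _ ≤ _ := by
          gcongr
          nlinarith [sq_nonneg (‖ρ₁ t‖ - ‖ρ₂ t‖), sq_nonneg ‖ρ₁ t‖, sq_nonneg ‖ρ₂ t‖]
  have hdom : Integrable fun t => M₁ * M₂ * (‖ρ₁ t‖ ^ 2 + ‖ρ₂ t‖ ^ 2) :=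
    ((integrable_sq_norm_resolventMap hc q₁).add
      (integrable_sq_norm_resolventMap hc q₂)).const_mul _
  have hab₁ : Integrable fun t => ‖p t * ρ₁ t * ofRealMap q₁‖ * ‖ρ₂ t * r t‖ := by
    refine (hdom.const_mul ‖ofRealMap q₁‖).mono' (ha'.norm.mul hb.norm).aestronglyMeasurable
      (Eventually.of_forall fun t => ?_)
    rw [Real.norm_of_nonneg (by positivity)]
    calc ‖p t * ρ₁ t * ofRealMap q₁‖ * ‖ρ₂ t * r t‖
        ≤ ‖p t * ρ₁ t‖ * ‖ofRealMap q₁‖ * ‖ρ₂ t * r t‖ := by gcongr; exact norm_mul_le _ _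
      _ = ‖ofRealMap q₁‖ * (‖p t * ρ₁ t‖ * ‖ρ₂ t * r t‖) := by ring
      _ ≤ _ := mul_le_mul_of_nonneg_left (hprod t) (norm_nonneg _)
  have hab₂ : Integrable fun t => ‖p t * ρ₁ t‖ * ‖ofRealMap q₂ * (ρ₂ t * r t)‖ := by
    refine (hdom.const_mul ‖ofRealMap q₂‖).mono' (ha.norm.mul hb'.norm).aestronglyMeasurable
      (Eventually.of_forall fun t => ?_)
    rw [Real.norm_of_nonneg (by positivity)]
    calc ‖p t * ρ₁ t‖ * ‖ofRealMap q₂ * (ρ₂ t * r t)‖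
        ≤ ‖p t * ρ₁ t‖ * (‖ofRealMap q₂‖ * ‖ρ₂ t * r t‖) := by gcongr; exact norm_mul_le _ _
      _ = ‖ofRealMap q₂‖ * (‖p t * ρ₁ t‖ * ‖ρ₂ t * r t‖) := by ring
      _ ≤ _ := mul_le_mul_of_nonneg_left (hprod t) (norm_nonneg _)
  set β := matrixCoefficient φ ψ u v with hβ
  have hint : ∀ {a : ℝ → C(X, ℂ)} {b : ℝ → C(Y, ℂ)}, Continuous a → Continuous b →
      (Integrable fun t => ‖a t‖ * ‖b t‖) → Integrable fun t => β (a t) (b t) := by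
    intro a b ha hb hab
    refine (hab.const_mul ‖β‖).mono'
      ((β.continuous.comp ha).clm_apply hb).aestronglyMeasurable
      (Eventually.of_forall fun t => ?_)
    rw [← mul_assoc]
    exact β.le_opNorm₂ _ _
  refine ⟨_, _, (hasSampledValue_integral hbd hlim ha' hb hab₁).sub
    (hasSampledValue_integral hbd hlim ha hb' hab₂), ?_, fun x y => ?_⟩
  · rw [← integral_sub (hint ha' hb hab₁) (hint ha hb' hab₂)]
    have hpt : ∀ t, β (p t * ρ₁ t * ofRealMap q₁) (ρ₂ t * r t)
        - β (p t * ρ₁ t) (ofRealMap q₂ * (ρ₂ t * r t))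
        = inner ℂ v (φ (p t * ρ₁ t) (D (ψ (ρ₂ t * r t) u))) := fun t => by
      rw [hβ, matrixCoefficient_apply, matrixCoefficient_apply, ← inner_sub_right,
        map_mul φ _ (ofRealMap q₁), map_mul ψ (ofRealMap q₂), mul_apply_eq_comp,
        mul_apply_eq_comp, ← map_sub, hD, sub_apply]
    simp_rw [hpt]
    obtain ⟨i₁, e₁⟩ := integral_sq_norm_resolventMap φ hc q₁ v
    obtain ⟨i₂, e₂⟩ := integral_sq_norm_resolventMap ψ hc q₂ u
    have hdom' := (((i₁.add i₂).div_const 2).const_mul (M₁ * M₂ * ‖D‖))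
    refine (norm_integral_le_of_norm_le hdom' (Eventually.of_forall fun t =>
      norm_inner_resolventMap_le φ ψ u v (hp t) (hr t) _ _ D)).trans (le_of_eq ?_)
    simp only [Pi.add_apply]
    rw [integral_const_mul, integral_div, integral_add i₁ i₂, e₁, e₂]
    ring
  · have h₁ := integrable_smul_of_norm_mul ha' hb hab₁ x
    have h₂ := integrable_smul_of_norm_mul ha hb' hab₂ x
    rw [← integral_sub h₁ h₂]
    refine (ContinuousMap.integral_apply (h₁.sub h₂) y).trans ?_
    refine integral_congr_ae (Eventually.of_forall fun t => ?_)
    simp only [ContinuousMap.sub_apply, ContinuousMap.smul_apply, ContinuousMap.mul_apply,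
      smul_eq_mul, hρ₁, hρ₂, resolventMap_apply, ofRealMap, ContinuousMap.coe_mk, Pi.sub_apply]
    ring

end Operators

section Strip

variable {H : Type*} [NormedAddCommGroup H] [InnerProductSpace ℂ H] [CompleteSpace H]

/-- The strip formula as an identity between sampled kernels. -/
lemma exists_hasSampledValue_strip {X Y : Type*} [MetricSpace X] [CompactSpace X] [MetricSpace Y]
    [CompactSpace Y] (φ : C(X, ℂ) →⋆ₐ[ℂ] (H →L[ℂ] H)) (ψ : C(Y, ℂ) →⋆ₐ[ℂ] (H →L[ℂ] H)) (u v : H)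
    {s : ℕ → Finset X} {χ : ℕ → X → C(X, ℂ)}
    (hbd : ∀ (n : ℕ) (a : C(X, ℂ)), ‖∑ i ∈ s n, a i • χ n i‖ ≤ ‖a‖)
    (hlim : ∀ a : C(X, ℂ), Tendsto (fun n => ∑ i ∈ s n, a i • χ n i) atTop (nhds a))
    (q₁ : C(X, ℝ)) (q₂ : C(Y, ℝ)) (p : ℝ → C(ℝ, C(X, ℂ))) (r : ℝ → C(ℝ, C(Y, ℂ))) {M₁ M₂ : ℝ}
    (hp : ∀ c, c ^ 2 = 1 → ∀ t, ‖p c t‖ ≤ M₁) (hr : ∀ c, c ^ 2 = 1 → ∀ t, ‖r c t‖ ≤ M₂)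
    {F : X → Y → ℂ → ℂ} (hF : ∀ x y, Differentiable ℂ (F x y)) {M : ℝ}
    (hM : ∀ x y (ζ : ℂ), |ζ.im| ≤ 1 → ‖F x y ζ‖ ≤ M)
    (hpr : ∀ (c t : ℝ) x y, p c t x * r c t y = F x y (t + c * Complex.I)) :
    ∃ (k : X → C(Y, ℂ)) (V : ℂ), HasSampledValue (matrixCoefficient φ ψ u v) s χ k V ∧
      ‖V‖ ≤ M₁ * M₂ * ‖φ (ofRealMap q₁) - ψ (ofRealMap q₂)‖ * ((‖u‖ ^ 2 + ‖v‖ ^ 2) / 2) ∧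
      ∀ x y, k x y = F x y (q₁ x) - F x y (q₂ y) := by
  have hcm : ((-1 : ℝ)) ^ 2 = 1 := by norm_num
  have hcp : ((1 : ℝ)) ^ 2 = 1 := by norm_num
  obtain ⟨k, V, hkV, hV, hk⟩ := exists_hasSampledValue_line φ ψ u v hbd hlim hcm q₁ q₂ (p (-1))
    (r (-1)) (hp _ hcm) (hr _ hcm)
  obtain ⟨k', V', hkV', hV', hk'⟩ := exists_hasSampledValue_line φ ψ u v hbd hlim hcp q₁ q₂ (p 1)
    (r 1) (hp _ hcp) (hr _ hcp)
  have hpi : (2 * Real.pi * Complex.I : ℂ) ≠ 0 := by simp [Real.pi_ne_zero]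
  refine ⟨_, _, (hkV.sub hkV').const_smul (2 * Real.pi * Complex.I : ℂ)⁻¹, ?_, fun x y => ?_⟩
  · rw [norm_mul, norm_inv]
    have hn : ‖(2 * Real.pi * Complex.I : ℂ)‖ = 2 * Real.pi := by
      simp [abs_of_pos Real.pi_pos]
    rw [hn, inv_mul_le_iff₀ (by positivity)]
    refine ((norm_sub_le _ _).trans (add_le_add hV hV')).trans (le_of_eq (by ring))
  · rw [ContinuousMap.smul_apply, ContinuousMap.sub_apply, hk, hk', smul_eq_mul,
      inv_mul_eq_iff_eq_mul₀ hpi, ← integral_strip_sub (hF x y) (hM x y) (q₁ x) (q₂ y)]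
    congr 1 <;>
    · refine integral_congr_ae (Eventually.of_forall fun t => ?_)
      dsimp only
      rw [← hpr]
      ring

/-- The boundary values `(t, x) ↦ G (g x) (t + c i)` of a translation covariant family of entire
functions. -/
noncomputable def boundaryMap {X : Type*} [TopologicalSpace X] {G : ℂ → ℂ → ℂ} {e : ℂ}
    (hshift : ∀ z (s : ℝ) ζ, G z (s + ζ) = G (z + s • e) ζ)
    (hcont : ∀ ζ, Continuous fun z => G z ζ) (g : C(X, ℂ)) (c : ℝ) : C(ℝ, C(X, ℂ)) :=
  ContinuousMap.curry ⟨fun p : ℝ × X => G (g p.2) (p.1 + c * Complex.I), by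
    simp_rw [hshift]
    exact (hcont _).comp (by fun_prop)⟩

lemma boundaryMap_apply {X : Type*} [TopologicalSpace X] {G : ℂ → ℂ → ℂ} {e : ℂ}
    (hshift : ∀ z (s : ℝ) ζ, G z (s + ζ) = G (z + s • e) ζ)
    (hcont : ∀ ζ, Continuous fun z => G z ζ) (g : C(X, ℂ)) (c t : ℝ) (x : X) :
    boundaryMap hshift hcont g c t x = G (g x) (t + c * Complex.I) := rfl

lemma norm_boundaryMap_le {X : Type*} [TopologicalSpace X] [CompactSpace X] {G : ℂ → ℂ → ℂ} {e : ℂ}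
    (hshift : ∀ z (s : ℝ) ζ, G z (s + ζ) = G (z + s • e) ζ)
    (hcont : ∀ ζ, Continuous fun z => G z ζ) (g : C(X, ℂ)) {M : ℝ}
    (hM : ∀ z (ζ : ℂ), |ζ.im| ≤ 1 → ‖G z ζ‖ ≤ M) {c : ℝ} (hc : c ^ 2 = 1) (t : ℝ) :
    ‖boundaryMap hshift hcont g c t‖ ≤ M := by
  refine (ContinuousMap.norm_le _ ((norm_nonneg _).trans (hM 0 0 (by simp)))).2 fun x => ?_
  have : |c| = 1 := (pow_eq_one_iff_of_nonneg (abs_nonneg c) two_ne_zero).1 (by rw [sq_abs, hc])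
  exact hM _ _ (by simp [this])

/-- The real part on a subset of the plane. -/
def reMap (X : Set ℂ) : C(X, ℝ) := ⟨fun x => (x : ℂ).re, by fun_prop⟩

/-- The imaginary part on a subset of the plane. -/
def imMap (X : Set ℂ) : C(X, ℝ) := ⟨fun x => (x : ℂ).im, by fun_prop⟩

/-- Perturbation bound for matrix coefficients of functions with entire extensions along the two
coordinate directions. -/
lemma norm_inner_sub_le {X Y : Set ℂ} [CompactSpace X] [CompactSpace Y]
    (φ : C(X, ℂ) →⋆ₐ[ℂ] (H →L[ℂ] H)) (ψ : C(Y, ℂ) →⋆ₐ[ℂ] (H →L[ℂ] H)) (u v : H) {h : C(ℂ, ℂ)}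
    {G₁ G₂ : ℂ → ℂ → ℂ} (hd₁ : ∀ z, Differentiable ℂ (G₁ z)) (hd₂ : ∀ z, Differentiable ℂ (G₂ z))
    (hv₁ : ∀ z (s : ℝ), G₁ z s = h (z + s • (1 : ℂ)))
    (hv₂ : ∀ z (s : ℝ), G₂ z s = h (z + s • Complex.I))
    (hs₁ : ∀ z (s : ℝ) ζ, G₁ z (s + ζ) = G₁ (z + s • (1 : ℂ)) ζ)
    (hs₂ : ∀ z (s : ℝ) ζ, G₂ z (s + ζ) = G₂ (z + s • Complex.I) ζ) {M₁ M₂ : ℝ}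
    (hM₁ : ∀ z (ζ : ℂ), |ζ.im| ≤ 1 → ‖G₁ z ζ‖ ≤ M₁)
    (hM₂ : ∀ z (ζ : ℂ), |ζ.im| ≤ 1 → ‖G₂ z ζ‖ ≤ M₂)
    (hc₁ : ∀ ζ, Continuous fun z => G₁ z ζ) (hc₂ : ∀ ζ, Continuous fun z => G₂ z ζ) {δ : ℝ}
    (hre : ‖φ (ofRealMap (reMap X)) - ψ (ofRealMap (reMap Y))‖ ≤ δ)
    (him : ‖φ (ofRealMap (imMap X)) - ψ (ofRealMap (imMap Y))‖ ≤ δ) :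
    ‖inner ℂ v ((φ (h.restrict X) - ψ (h.restrict Y)) u)‖ ≤
      (M₁ + M₂) * δ * ((‖u‖ ^ 2 + ‖v‖ ^ 2) / 2) := by
  have hM₁0 : 0 ≤ M₁ := (norm_nonneg _).trans (hM₁ 0 0 (by simp))
  have hM₂0 : 0 ≤ M₂ := (norm_nonneg _).trans (hM₂ 0 0 (by simp))
  have hone : ∀ {Z : Set ℂ} [CompactSpace Z], ‖(1 : C(Z, ℂ))‖ ≤ 1 := fun {Z} _ =>
    (ContinuousMap.norm_le _ zero_le_one).2 fun x => by simp
  obtain ⟨s, χ, hbd, hlim⟩ := exists_sampling X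
  obtain ⟨k, V, hkV, hV, hk⟩ := exists_hasSampledValue_strip φ ψ u v hbd hlim (imMap X) (imMap Y)
    (boundaryMap hs₂ hc₂ (ofRealMap (reMap X))) (fun _ => ContinuousMap.const ℝ 1)
    (F := fun x _ => G₂ (ofRealMap (reMap X) x))
    (fun c hc t => norm_boundaryMap_le hs₂ hc₂ _ hM₂ hc t) (fun _ _ _ => hone)
    (fun x _ => hd₂ _) (fun x _ => hM₂ _) (fun c t x y => by simp [boundaryMap_apply])
  obtain ⟨k', V', hkV', hV', hk'⟩ := exists_hasSampledValue_strip φ ψ u v hbd hlim (reMap X)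
    (reMap Y) (fun _ => ContinuousMap.const ℝ 1)
    (boundaryMap hs₁ hc₁ (Complex.I • ofRealMap (imMap Y)))
    (F := fun _ y => G₁ ((Complex.I • ofRealMap (imMap Y)) y)) (fun _ _ _ => hone)
    (fun c hc t => norm_boundaryMap_le hs₁ hc₁ _ hM₁ hc t)
    (fun _ y => hd₁ _) (fun _ y => hM₁ _) (fun c t x y => by simp [boundaryMap_apply])
  have hl := hkV.add hkV'
  have hr := (hasSampledValue_smul (β := matrixCoefficient φ ψ u v) hlim (h.restrict X) 1).sub
    (hasSampledValue_smul (β := matrixCoefficient φ ψ u v) hlim 1 (h.restrict Y))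
  have hker : (fun x => k x + k' x)
      = fun x => h.restrict X x • (1 : C(Y, ℂ)) - (1 : C(X, ℂ)) x • h.restrict Y := by
    funext x
    ext y
    have e₁ : ∀ z : ℂ, (z.re : ℂ) + z.im • Complex.I = z := fun z => by
      rw [Complex.real_smul, Complex.re_add_im]
    have e₂ : ∀ z : ℂ, Complex.I * (z.im : ℂ) + z.re • (1 : ℂ) = z := fun z => by
      rw [Complex.real_smul, mul_one, add_comm, mul_comm, Complex.re_add_im]
    have e₃ : Complex.I * ((y : ℂ).im : ℂ) + (x : ℂ).re • (1 : ℂ)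
        = ((x : ℂ).re : ℂ) + (y : ℂ).im • Complex.I := by
      rw [Complex.real_smul, Complex.real_smul]
      ring
    simp only [ContinuousMap.add_apply, ContinuousMap.sub_apply, ContinuousMap.smul_apply, hk, hk',
      hv₁, hv₂, ofRealMap, reMap, imMap, ContinuousMap.coe_mk, ContinuousMap.one_apply,
      ContinuousMap.restrict_apply, smul_eq_mul, mul_one, one_mul, e₁, e₂, e₃]
    ring
  rw [hker] at hl
  have hval := tendsto_nhds_unique hr hl
  rw [matrixCoefficient_apply, matrixCoefficient_apply, map_one, map_one, one_apply_eq_self,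
    one_apply_eq_self, ← inner_sub_right, ← sub_apply] at hval
  rw [hval]
  calc ‖V + V'‖ ≤ ‖V‖ + ‖V'‖ := norm_add_le _ _
    _ ≤ M₂ * 1 * δ * ((‖u‖ ^ 2 + ‖v‖ ^ 2) / 2) + 1 * M₁ * δ * ((‖u‖ ^ 2 + ‖v‖ ^ 2) / 2) := by
      refine add_le_add (hV.trans ?_) (hV'.trans ?_) <;> gcongr
    _ = _ := by ring

end Strip

/-! ### Normal operators -/

section Normal

variable {H : Type*} [NormedAddCommGroup H] [InnerProductSpace ℂ H] [CompleteSpace H]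

lemma cfcHom_ofRealMap_reMap {N : H →L[ℂ] H} (hN : IsStarNormal N) :
    cfcHom hN (ofRealMap (reMap (spectrum ℂ N))) = (1 / 2 : ℂ) • (N + star N) := by
  have : ofRealMap (reMap (spectrum ℂ N)) = (1 / 2 : ℂ) •
      ((ContinuousMap.id ℂ).restrict (spectrum ℂ N)
        + star ((ContinuousMap.id ℂ).restrict (spectrum ℂ N))) := by
    ext z
    simp [ofRealMap, reMap, Complex.re_eq_add_conj, div_eq_inv_mul]
  rw [this, map_smul, map_add, map_star, cfcHom_id]

lemma cfcHom_ofRealMap_imMap {N : H →L[ℂ] H} (hN : IsStarNormal N) :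
    cfcHom hN (ofRealMap (imMap (spectrum ℂ N))) = (2 * Complex.I)⁻¹ • (N - star N) := by
  have : ofRealMap (imMap (spectrum ℂ N)) = (2 * Complex.I)⁻¹ •
      ((ContinuousMap.id ℂ).restrict (spectrum ℂ N)
        - star ((ContinuousMap.id ℂ).restrict (spectrum ℂ N))) := by
    ext z
    simp [ofRealMap, imMap, Complex.im_eq_sub_conj, div_eq_inv_mul, mul_comm]
  rw [this, map_smul, map_sub, map_star, cfcHom_id]

lemma norm_cfcHom_reMap_sub_le {N₁ N₂ : H →L[ℂ] H} (h₁ : IsStarNormal N₁) (h₂ : IsStarNormal N₂) :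
    ‖cfcHom h₁ (ofRealMap (reMap (spectrum ℂ N₁))) - cfcHom h₂ (ofRealMap (reMap (spectrum ℂ N₂)))‖
      ≤ ‖N₁ - N₂‖ := by
  rw [cfcHom_ofRealMap_reMap, cfcHom_ofRealMap_reMap, ← smul_sub, add_sub_add_comm, ← star_sub,
    norm_smul]
  have := norm_add_le (N₁ - N₂) (star (N₁ - N₂))
  rw [norm_star, star_sub] at this
  norm_num
  linarith

lemma norm_cfcHom_imMap_sub_le {N₁ N₂ : H →L[ℂ] H} (h₁ : IsStarNormal N₁) (h₂ : IsStarNormal N₂) :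
    ‖cfcHom h₁ (ofRealMap (imMap (spectrum ℂ N₁))) - cfcHom h₂ (ofRealMap (imMap (spectrum ℂ N₂)))‖
      ≤ ‖N₁ - N₂‖ := by
  rw [cfcHom_ofRealMap_imMap, cfcHom_ofRealMap_imMap, ← smul_sub, sub_sub_sub_comm, ← star_sub,
    norm_smul]
  have := norm_sub_le (N₁ - N₂) (star (N₁ - N₂))
  rw [norm_star, star_sub] at this
  norm_num
  linarith

end Normal

lemma ReproducedBy.exists_norm_cfc_sub_le (K : SchwartzMap ℂ ℂ) :
    ∃ C : ℝ, 0 ≤ C ∧ ∀ h : BoundedContinuousFunction ℂ ℂ, ReproducedBy K h →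
      ∀ (H : Type*) [NormedAddCommGroup H] [InnerProductSpace ℂ H] [CompleteSpace H]
        (N₁ N₂ : H →L[ℂ] H), IsStarNormal N₁ → IsStarNormal N₂ →
        ‖cfc (⇑h) N₁ - cfc (⇑h) N₂‖ ≤ C * ‖h‖ * ‖N₁ - N₂‖ := by
  obtain ⟨B₁, hB₁, hext₁⟩ := ReproducedBy.exists_entire_extension K 1
  obtain ⟨B₂, hB₂, hext₂⟩ := ReproducedBy.exists_entire_extension K Complex.I
  refine ⟨B₁ + B₂, add_nonneg hB₁ hB₂, fun h hh H _ _ _ N₁ N₂ hN₁ hN₂ => ?_⟩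
  obtain ⟨G₁, hd₁, hv₁, hs₁, hM₁, hc₁⟩ := hext₁ h hh
  obtain ⟨G₂, hd₂, hv₂, hs₂, hM₂, hc₂⟩ := hext₂ h hh
  refine ContinuousLinearMap.opNorm_le_of_re_inner_le (𝕜 := ℂ) (by positivity)
    fun u v hu hv => ?_
  have hcfc : ∀ {N : H →L[ℂ] H} (hN : IsStarNormal N),
      cfc (⇑h) N = cfcHom hN (h.toContinuousMap.restrict (spectrum ℂ N)) := fun {N} hN =>
    cfc_apply _ _ hN h.continuous.continuousOn
  have hmain := norm_inner_sub_le (h := h.toContinuousMap) (cfcHom hN₁) (cfcHom hN₂) u v hd₁ hd₂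
    hv₁ hv₂ hs₁ hs₂ hM₁ hM₂ hc₁ hc₂ (norm_cfcHom_reMap_sub_le hN₁ hN₂)
    (norm_cfcHom_imMap_sub_le hN₁ hN₂)
  rw [← hcfc hN₁, ← hcfc hN₂, hu, hv] at hmain
  rw [inner_re_symm]
  refine (RCLike.re_le_norm _).trans (hmain.trans (le_of_eq ?_))
  ring

/-- There is an absolute constant `C > 0` such that for every `σ > 0`, every bounded
continuous `f : ℂ → ℂ` with Fourier transform supported in the closed disc of radius `σ`,
and all bounded normal operators `N₁, N₂` on a complex Hilbert space `H`,
`‖f(N₁) - f(N₂)‖ ≤ C σ ‖f‖_∞ ‖N₁ - N₂‖`. -/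
theorem key_inequality_band_limited :
    ∃ C : ℝ, 0 < C ∧
      ∀ (σ : ℝ), 0 < σ →
      ∀ f : BoundedContinuousFunction ℂ ℂ, FourierSupportedIn (⇑f) σ →
      ∀ (H : Type*) [NormedAddCommGroup H] [InnerProductSpace ℂ H] [CompleteSpace H]
        (N₁ N₂ : H →L[ℂ] H), IsStarNormal N₁ → IsStarNormal N₂ →
        ‖cfc (⇑f) N₁ - cfc (⇑f) N₂‖ ≤ C * σ * ‖f‖ * ‖N₁ - N₂‖ := by
  obtain ⟨C, hC, hmain⟩ := ReproducedBy.exists_norm_cfc_sub_le reproKernel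
  refine ⟨C + 1, by positivity, fun σ hσ f hf H _ _ _ N₁ N₂ hN₁ hN₂ => ?_⟩
  have hσ0 : (σ : ℂ) ≠ 0 := by exact_mod_cast hσ.ne'
  let h : BoundedContinuousFunction ℂ ℂ :=
    f.compContinuous ⟨fun z => (σ : ℂ)⁻¹ * z, by fun_prop⟩
  have hh : ReproducedBy reproKernel h := fun z => by
    have := eq_integral_reproKernel hσ hf ((σ : ℂ)⁻¹ * z) (inv_pos.2 hσ) le_rfl
    refine Eq.trans ?_ this
    refine integral_congr_ae (Eventually.of_forall fun s => ?_)
    simp [h, mul_add]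
  have hnorm : ‖h‖ ≤ ‖f‖ := f.norm_compContinuous_le _
  have hnormal : ∀ {N : H →L[ℂ] H}, IsStarNormal N → IsStarNormal ((σ : ℂ) • N) := fun hN =>
    ⟨by simpa [commute_iff_eq, smul_smul, mul_comm] using congrArg _ hN.star_comm_self.eq⟩
  have hcfc : ∀ {N : H →L[ℂ] H}, IsStarNormal N → cfc (⇑h) ((σ : ℂ) • N) = cfc (⇑f) N := by
    intro N hN
    rw [← cfc_comp_const_mul (σ : ℂ) (⇑h) N h.continuous.continuousOn hN]
    congr 1
    funext z
    simp [h, inv_mul_cancel_left₀ hσ0]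
  have := hmain h hh H _ _ (hnormal hN₁) (hnormal hN₂)
  rw [hcfc hN₁, hcfc hN₂, ← smul_sub, norm_smul, Complex.norm_real,
    Real.norm_of_nonneg hσ.le] at this
  calc ‖cfc (⇑f) N₁ - cfc (⇑f) N₂‖ ≤ C * ‖h‖ * (σ * ‖N₁ - N₂‖) := this
    _ ≤ (C + 1) * ‖f‖ * (σ * ‖N₁ - N₂‖) := by gcongr; linarith
    _ = (C + 1) * σ * ‖f‖ * ‖N₁ - N₂‖ := by ring
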